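/- arXiv:1603.07167 — 4 statements merged into one kernel-verified Lean document; each statement's English description precedes it below -/
import Mathlib

section
/- Let E be a locally compact Polish space and Q a transition function satisfying the standing hypotheses (H). Then for every bounded continuous function F : E → ℝ, the map (s,t,x) ↦ U(s,t)F(x) = ∫_E F(y) P(s,x;t,dy) is continuous on {(s,t) : 0 ≤ s ≤ t} × E (i.e. U(s,t) is a Feller evolution system). -/
open MeasureTheory Set

variable {E : Type*}

/-- The cumulative intensity `q(t,x) = Q(t,x,E)`. -/
noncomputable def qIntensity [MeasurableSpace E] (Q : ℝ → E → Measure E) (t : ℝ) (x : E) : ℝ :=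
  (Q t x univ).toReal

/-- The iterated kernels `P⁽ⁿ⁾(s,x;t,·)`. -/
noncomputable def Piter [MeasurableSpace E] (Q : ℝ → E → Measure E) :
    ℕ → ℝ → ℝ → E → Measure E
  | 0, s, t, x =>
      ENNReal.ofReal (Real.exp (-∫ r in s..t, qIntensity Q r x)) • Measure.dirac x
  | n + 1, s, t, x =>
      Measure.bind
        ((volume.restrict (Ioc s t)).withDensity fun r =>
          ENNReal.ofReal (Real.exp (-∫ τ in s..r, qIntensity Q τ x)))
        fun r => Measure.bind (Q r x) fun y => Piter Q n r t y

/-- The minimal transition function `P(s,x;t,·) = Σ_n P⁽ⁿ⁾(s,x;t,·)`. -/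
noncomputable def Pmin [MeasurableSpace E] (Q : ℝ → E → Measure E) (s t : ℝ) (x : E) :
    Measure E :=
  Measure.sum fun n => Piter Q n s t x

/-- The evolution system `U(s,t)F(x) = ∫_E F(y) P(s,x;t,dy)`. -/
noncomputable def Umin [MeasurableSpace E] (Q : ℝ → E → Measure E) (s t : ℝ) (F : E → ℝ)
    (x : E) : ℝ :=
  ∫ y, F y ∂(Pmin Q s t x)

/-- `Q` is a transition function. -/
def IsTransitionFunction [MeasurableSpace E] [TopologicalSpace E]
    (Q : ℝ → E → Measure E) : Prop :=
  (∀ t x, 0 ≤ t → IsFiniteMeasure (Q t x)) ∧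
  (∀ t x, 0 ≤ t → Q t x {x} = 0) ∧
  (∀ A : Set E, MeasurableSet A → Measurable fun p : ℝ × E => Q p.1 p.2 A) ∧
  (∀ T > (0 : ℝ), ∀ B : Set E, IsCompact B →
    ∃ C : ℝ, ∀ t ∈ Icc (0 : ℝ) T, ∀ x ∈ B, (Q t x univ).toReal ≤ C)

/-- The standing hypotheses (H). -/
structure StandingHypotheses [MeasurableSpace E] [TopologicalSpace E]
    (Q : ℝ → E → Measure E) (V : E → ℝ) (c : ℝ → ℝ) : Prop where
  V_cont : Continuous V
  V_nonneg : ∀ x, 0 ≤ V x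
  c_cont : Continuous c
  c_nonneg : ∀ t, 0 ≤ c t
  weak_cont : ∀ F : E → ℝ, Continuous F → (∃ M : ℝ, ∀ x, |F x| ≤ M * (1 + V x)) →
    ContinuousOn (fun p : ℝ × E => ∫ y, F y ∂(Q p.1 p.2)) {p : ℝ × E | 0 ≤ p.1}
  q_bound : ∀ T > (0 : ℝ), ∃ a > (0 : ℝ), ∀ t ∈ Icc (0 : ℝ) T, ∀ x,
    qIntensity Q t x ≤ a * V x
  lyapunov : ∀ t : ℝ, 0 ≤ t → ∀ x,
    ∫⁻ y, ENNReal.ofReal (V y) ∂(Q t x)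
      ≤ ENNReal.ofReal (c t * V x + qIntensity Q t x * V x)
  localization : ∀ ε > (0 : ℝ), ∀ B : Set E, IsCompact B → ∀ T > (0 : ℝ),
    ∃ A : Set E, IsCompact A ∧ ∀ x ∈ B, ∫ r in (0 : ℝ)..T, (Q r x Aᶜ).toReal < ε

open Filter Topology BoundedContinuousFunction

/-- A family of finite measures on `E`, indexed by time and space, that depends weakly
continuously on its index. -/
structure IsFellerRate [MeasurableSpace E] [TopologicalSpace E]
    (R : ℝ → E → Measure E) : Prop where
  finite : ∀ t x, IsFiniteMeasure (R t x)
  continuous_integral : ∀ f : E →ᵇ ℝ, Continuous fun p : ℝ × E => ∫ y, f y ∂(R p.1 p.2)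

section WeakContinuity

variable [MeasurableSpace E] [TopologicalSpace E] [BorelSpace E] [PolishSpace E]

/-- If `μ z` depends weakly continuously on `z` and `g` is jointly continuous and bounded, then
`z ↦ ∫ g (z, y) dμ_z(y)` is continuous. -/
theorem continuous_integral_of_weaklyContinuous [LocallyCompactSpace E] {Z : Type*}
    [TopologicalSpace Z]
    {μ : Z → Measure E} (hfin : ∀ z, IsFiniteMeasure (μ z))
    (hμ : ∀ f : E →ᵇ ℝ, Continuous fun z => ∫ y, f y ∂(μ z)) (g : Z × E →ᵇ ℝ) :
    Continuous fun z => ∫ y, g (z, y) ∂(μ z) := by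
  have sec (z : Z) : Continuous fun y => g (z, y) := by fun_prop
  set M := ‖g‖ with hM
  have hg (p) : |g p| ≤ M := g.norm_coe_le_norm p
  have hM0 : 0 ≤ M := norm_nonneg _
  have hint (z z' : Z) : Integrable (fun y => g (z', y)) (μ z) :=
    Integrable.of_bound (sec z').aestronglyMeasurable M (.of_forall fun y => hg _)
  rw [continuous_iff_continuousAt]
  intro z₀
  rw [ContinuousAt, Metric.tendsto_nhds]
  intro ε hε
  set δ : ℝ := ε / (4 * (1 + 2 * M) * (1 + (μ z₀).real univ)) with hδ
  have hm : 0 ≤ (μ z₀).real univ := measureReal_nonneg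
  have hδ0 : 0 < δ := by positivity
  obtain ⟨K, -, hK, hKμ⟩ := MeasurableSet.univ.exists_isCompact_sdiff_lt (μ := μ z₀)
    (measure_ne_top _ _) (ε := ENNReal.ofReal δ) (by simpa using hδ0)
  obtain ⟨χ, hχK, -, hχc, hχ⟩ := exists_continuous_one_zero_of_isCompact hK isClosed_empty
    (disjoint_empty K)
  let ψ : E →ᵇ ℝ := BoundedContinuousFunction.ofNormedAddCommGroup (fun y => 1 - χ y)
    (by fun_prop) 1 (fun y => by
      rw [Real.norm_eq_abs, abs_le]; have := hχ y; constructor <;> linarith [this.1, this.2])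
  have hψ (y) : ψ y = 1 - χ y := rfl
  have hψ0 : ∫ y, ψ y ∂(μ z₀) ≤ δ := by
    calc ∫ y, ψ y ∂(μ z₀) ≤ ∫ y, (Kᶜ).indicator (fun _ => (1 : ℝ)) y ∂(μ z₀) := by
          refine integral_mono (ψ.integrable _)
            ((integrable_const _).indicator hK.measurableSet.compl) fun y => ?_
          by_cases hy : y ∈ K
          · simp [hψ, hy, hχK hy]
          · simp [hψ, hy, (hχ y).1]
      _ = (μ z₀).real Kᶜ := by
          rw [integral_indicator hK.measurableSet.compl]; simp
      _ ≤ δ := by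
          rw [compl_eq_univ_sdiff]
          exact ENNReal.toReal_le_of_le_ofReal hδ0.le hKμ.le
  have h1 : ∀ᶠ z in 𝓝 z₀, ∀ y ∈ tsupport χ, |g (z, y) - g (z₀, y)| ≤ δ := by
    apply IsCompact.eventually_forall_of_forall_eventually hχc
    intro y _
    have : Continuous fun p : Z × E => |g (p.1, p.2) - g (z₀, p.2)| := by fun_prop
    have h2 := this.tendsto (z₀, y)
    simp only [sub_self, abs_zero] at h2
    exact (h2.eventually (gt_mem_nhds hδ0)).mono fun p hp => hp.le
  have h2 : ∀ᶠ z in 𝓝 z₀, ∫ y, ψ y ∂(μ z) < 2 * δ :=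
    (hμ ψ).continuousAt.eventually (gt_mem_nhds (by linarith))
  have h3 : ∀ᶠ z in 𝓝 z₀, (μ z).real univ < (μ z₀).real univ + 1 := by
    have := hμ (BoundedContinuousFunction.const E 1)
    simp only [BoundedContinuousFunction.const_apply, integral_const, smul_eq_mul, mul_one] at this
    exact this.continuousAt.eventually (gt_mem_nhds (by linarith))
  let g₀ : E →ᵇ ℝ := g.compContinuous ⟨fun y => (z₀, y), by fun_prop⟩
  have h4 : ∀ᶠ z in 𝓝 z₀, |∫ y, g (z₀, y) ∂(μ z) - ∫ y, g (z₀, y) ∂(μ z₀)| < ε / 4 := by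
    have := (hμ g₀).tendsto z₀
    rw [Metric.tendsto_nhds] at this
    exact this (ε / 4) (by linarith)
  filter_upwards [h1, h2, h3, h4] with z h1 h2 h3 h4
  have key : |∫ y, g (z, y) ∂(μ z) - ∫ y, g (z₀, y) ∂(μ z)|
      ≤ δ * (μ z).real univ + 2 * M * ∫ y, ψ y ∂(μ z) := by
    rw [← integral_sub (hint _ _) (hint _ _)]
    have e : δ * (μ z).real univ + 2 * M * ∫ y, ψ y ∂(μ z) =
        ∫ y, (δ + 2 * M * ψ y) ∂(μ z) := by
      rw [integral_add (integrable_const _) ((ψ.integrable _).const_mul _), integral_const_mul]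
      simp [mul_comm]
    rw [e]
    refine (abs_integral_le_integral_abs).trans (integral_mono ((hint _ _).sub (hint _ _)).abs
      ((integrable_const _).add ((ψ.integrable _).const_mul _)) fun y => ?_)
    by_cases hy : y ∈ tsupport χ
    · have : 0 ≤ ψ y := by rw [hψ]; linarith [(hχ y).2]
      have := mul_nonneg hM0 this
      exact (h1 y hy).trans (by linarith)
    · have : χ y = 0 := image_eq_zero_of_notMem_tsupport hy
      have h5 := abs_sub (g (z, y)) (g (z₀, y))
      simp only [hψ, this]
      linarith [hg (z, y), hg (z₀, y)]
  rw [Real.dist_eq]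
  have h6 : δ * (μ z).real univ + 2 * M * ∫ y, ψ y ∂(μ z)
      ≤ δ * ((μ z₀).real univ + 1) + 2 * M * (2 * δ) := by gcongr
  have h7 : δ * (2 * (1 + 2 * M) * (1 + (μ z₀).real univ)) = ε / 2 := by
    rw [hδ]; field_simp; ring
  have h8 : δ * ((μ z₀).real univ + 1) + 2 * M * (2 * δ)
      ≤ δ * (2 * (1 + 2 * M) * (1 + (μ z₀).real univ)) := by
    have : 0 ≤ δ * M := by positivity
    have : 0 ≤ δ * (μ z₀).real univ := by positivity
    have : 0 ≤ δ * M * (μ z₀).real univ := by positivity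
    nlinarith
  have h9 := abs_sub_le (∫ y, g (z, y) ∂(μ z)) (∫ y, g (z₀, y) ∂(μ z)) (∫ y, g (z₀, y) ∂(μ z₀))
  linarith

/-- A family of finite measures is measurable if it integrates bounded continuous nonnegative
functions measurably. -/
theorem measurable_measure_of_lintegral_boundedContinuous {α : Type*} [MeasurableSpace α]
    {μ : α → Measure E} (hfin : ∀ a, IsFiniteMeasure (μ a))
    (h : ∀ f : E →ᵇ ℝ, 0 ≤ f → Measurable fun a => ∫⁻ y, ENNReal.ofReal (f y) ∂(μ a)) :
    Measurable μ := by
  let _ := TopologicalSpace.upgradeIsCompletelyMetrizable E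
  have hc : ∀ A : Set E, IsClosed A → Measurable fun a => μ a A := fun A hA => by
    refine measurable_of_tendsto_metrizable (f := fun n a => ∫⁻ y, hA.apprSeq n y ∂(μ a))
      (fun n => ?_) (tendsto_pi_nhds.2 fun a =>
        HasOuterApproxClosed.tendsto_lintegral_apprSeq hA (μ a))
    let f : E →ᵇ ℝ := BoundedContinuousFunction.ofNormedAddCommGroup
      (fun y => ((hA.apprSeq n y : NNReal) : ℝ)) (by fun_prop) 1 (fun y => by
        have := HasOuterApproxClosed.apprSeq_apply_le_one hA n y
        simpa using this)
    have hf := h f fun y => NNReal.coe_nonneg _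
    have e (y : E) : ENNReal.ofReal (f y) = (hA.apprSeq n y : ENNReal) :=
      ENNReal.ofReal_coe_nnreal
    simpa only [e] using hf
  exact Measurable.measure_of_isPiSystem
    ((BorelSpace.measurable_eq (α := E)).trans borel_eq_generateFrom_isClosed)
    isPiSystem_isClosed (fun A hA => hc A hA) (hc univ isClosed_univ)

end WeakContinuity
section JumpStep

/-- The cumulative intensity `∫_s^t q(r,x) dr`. -/
noncomputable def cumIntensity [MeasurableSpace E] (R : ℝ → E → Measure E) (s t : ℝ) (x : E) : ℝ :=
  ∫ r in s..t, qIntensity R r x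

/-- The operator that waits for the first jump before the time horizon, and evaluates the given
function of (time, horizon, state) there. -/
noncomputable def jumpFun [MeasurableSpace E] (R : ℝ → E → Measure E) (g : ℝ × ℝ × E → ℝ)
    (p : ℝ × ℝ × E) : ℝ :=
  ∫ r in p.1..max p.1 p.2.1,
    Real.exp (-cumIntensity R p.1 r p.2.2) * ∫ y, g (r, p.2.1, y) ∂(R r p.2.2)

variable [MeasurableSpace E] [TopologicalSpace E] {R : ℝ → E → Measure E}

namespace IsFellerRate

theorem continuous_qIntensity (hR : IsFellerRate R) :
    Continuous fun p : ℝ × E => qIntensity R p.1 p.2 := by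
  have := hR.continuous_integral (BoundedContinuousFunction.const E 1)
  simp only [BoundedContinuousFunction.const_apply, integral_const, smul_eq_mul, mul_one] at this
  exact this

theorem jumpFun_smul (c : ℝ) (f : ℝ × ℝ × E →ᵇ ℝ) (p : ℝ × ℝ × E) :
    jumpFun R ⇑(c • f) p = c * jumpFun R f p := by
  unfold jumpFun
  rw [← intervalIntegral.integral_const_mul]
  congr 1 with r
  simp only [BoundedContinuousFunction.coe_smul, smul_eq_mul]
  rw [integral_const_mul]
  ring

theorem continuous_cumIntensity (hR : IsFellerRate R) :
    Continuous fun p : ℝ × ℝ × E => cumIntensity R p.1 p.2.1 p.2.2 := by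
  have hq := hR.continuous_qIntensity
  have hi (x : E) (a b : ℝ) : IntervalIntegrable (fun r => qIntensity R r x) volume a b :=
    (hq.comp (by fun_prop : Continuous fun r : ℝ => (r, x))).intervalIntegrable _ _
  have e : (fun p : ℝ × ℝ × E => cumIntensity R p.1 p.2.1 p.2.2) = fun p =>
      (∫ r in (0 : ℝ)..p.2.1, qIntensity R r p.2.2) - ∫ r in (0 : ℝ)..p.1, qIntensity R r p.2.2 := by
    funext p
    rw [cumIntensity, intervalIntegral.integral_interval_sub_left (hi _ _ _) (hi _ _ _)]
  rw [e]
  have hq' : Continuous (Function.uncurry fun (p : ℝ × ℝ × E) r => qIntensity R r p.2.2) :=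
    hq.comp (by fun_prop : Continuous fun p : (ℝ × ℝ × E) × ℝ => (p.2, p.1.2.2))
  exact (intervalIntegral.continuous_parametric_intervalIntegral_of_continuous hq'
    (by fun_prop)).sub
    (intervalIntegral.continuous_parametric_intervalIntegral_of_continuous hq' (by fun_prop))

theorem hasDerivAt_cumIntensity (hR : IsFellerRate R) (s r : ℝ) (x : E) :
    HasDerivAt (fun r => cumIntensity R s r x) (qIntensity R r x) r := by
  have hc : Continuous fun r => qIntensity R r x :=
    hR.continuous_qIntensity.comp (by fun_prop : Continuous fun r : ℝ => (r, x))
  exact intervalIntegral.integral_hasDerivAt_right (hc.intervalIntegrable _ _)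
    hc.stronglyMeasurable.stronglyMeasurableAtFilter hc.continuousAt

theorem hasDerivAt_exp_neg_cumIntensity (hR : IsFellerRate R) (s r : ℝ) (x : E) :
    HasDerivAt (fun r => Real.exp (-cumIntensity R s r x))
      (-(Real.exp (-cumIntensity R s r x) * qIntensity R r x)) r := by
  have h := (hR.hasDerivAt_cumIntensity s r x).neg.exp
  rw [mul_neg] at h
  exact h

/-- The contribution `F(x) exp(-∫_s^t q(r,x) dr)` of the paths without jumps. -/
noncomputable def noJump (hR : IsFellerRate R) (F : E →ᵇ ℝ) : ℝ × ℝ × E →ᵇ ℝ :=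
  BoundedContinuousFunction.ofNormedAddCommGroup
    (fun p => F p.2.2 * Real.exp (-cumIntensity R p.1 (max p.1 p.2.1) p.2.2))
    (by
      have := hR.continuous_cumIntensity.comp
        (by fun_prop : Continuous fun p : ℝ × ℝ × E => (p.1, max p.1 p.2.1, p.2.2))
      exact (by fun_prop : Continuous fun p : ℝ × ℝ × E => F p.2.2).mul
        (Real.continuous_exp.comp this.neg)) ‖F‖
    (fun p => by
      have h : 0 ≤ cumIntensity R p.1 (max p.1 p.2.1) p.2.2 :=
        intervalIntegral.integral_nonneg (le_max_left _ _) fun r _ => ENNReal.toReal_nonneg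
      rw [norm_mul, Real.norm_of_nonneg (Real.exp_pos _).le]
      exact (mul_le_of_le_one_right (norm_nonneg _) (Real.exp_le_one_iff.2 (by linarith))).trans
        (F.norm_coe_le_norm _))

theorem noJump_apply (hR : IsFellerRate R) (F : E →ᵇ ℝ) (p : ℝ × ℝ × E) :
    hR.noJump F p = F p.2.2 * Real.exp (-cumIntensity R p.1 (max p.1 p.2.1) p.2.2) := rfl

theorem noJump_nonneg (hR : IsFellerRate R) {F : E →ᵇ ℝ} (hF : 0 ≤ F) : 0 ≤ hR.noJump F :=
  fun _ => mul_nonneg (hF _) (Real.exp_pos _).le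

variable [BorelSpace E]

theorem integrable (hR : IsFellerRate R) (f : E →ᵇ ℝ) (t : ℝ) (x : E) : Integrable f (R t x) :=
  have := hR.finite t x
  f.integrable _

theorem sectionIntegrable (hR : IsFellerRate R) (g : ℝ × ℝ × E →ᵇ ℝ) (r t : ℝ) (x : E) :
    Integrable (fun y => g (r, t, y)) (R r x) :=
  hR.integrable (g.compContinuous ⟨fun y => (r, t, y), by fun_prop⟩) r x

variable [PolishSpace E] [LocallyCompactSpace E]

/-- Joint continuity of the integrand in the definition of `jumpFun`. -/
theorem continuous_jumpIntegrand (hR : IsFellerRate R) (g : ℝ × ℝ × E →ᵇ ℝ) :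
    Continuous (Function.uncurry fun (p : ℝ × ℝ × E) (r : ℝ) =>
      Real.exp (-cumIntensity R p.1 r p.2.2) * ∫ y, g (r, p.2.1, y) ∂(R r p.2.2)) := by
  let k : C(((ℝ × ℝ × E) × ℝ) × E, ℝ × ℝ × E) := ⟨fun z => (z.1.2, z.1.1.2.1, z.2), by fun_prop⟩
  have h1 := continuous_integral_of_weaklyContinuous
    (μ := fun z : (ℝ × ℝ × E) × ℝ => R z.2 z.1.2.2) (fun z => hR.finite _ _)
    (fun f => (hR.continuous_integral f).comp
      (by fun_prop : Continuous fun z : (ℝ × ℝ × E) × ℝ => (z.2, z.1.2.2))) (g.compContinuous k)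
  have h2 := hR.continuous_cumIntensity.comp
    (by fun_prop : Continuous fun z : (ℝ × ℝ × E) × ℝ => (z.1.1, z.2, z.1.2.2))
  exact (Real.continuous_exp.comp h2.neg).mul h1

theorem continuous_jumpIntegrand_right (hR : IsFellerRate R) (g : ℝ × ℝ × E →ᵇ ℝ)
    (s t : ℝ) (x : E) : Continuous fun r =>
      Real.exp (-cumIntensity R s r x) * ∫ y, g (r, t, y) ∂(R r x) :=
  (hR.continuous_jumpIntegrand g).comp
    (by fun_prop : Continuous fun r : ℝ => ((s, t, x), r))

theorem continuous_jumpFun (hR : IsFellerRate R) (g : ℝ × ℝ × E →ᵇ ℝ) :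
    Continuous (jumpFun R g) := by
  have h := hR.continuous_jumpIntegrand g
  have e : jumpFun R g = fun p : ℝ × ℝ × E =>
      (∫ r in (0 : ℝ)..max p.1 p.2.1,
        Real.exp (-cumIntensity R p.1 r p.2.2) * ∫ y, g (r, p.2.1, y) ∂(R r p.2.2)) -
      ∫ r in (0 : ℝ)..p.1,
        Real.exp (-cumIntensity R p.1 r p.2.2) * ∫ y, g (r, p.2.1, y) ∂(R r p.2.2) := by
    funext p
    have hi (a b : ℝ) :=
      (hR.continuous_jumpIntegrand_right g p.1 p.2.1 p.2.2).intervalIntegrable (μ := volume) a b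
    rw [jumpFun, intervalIntegral.integral_interval_sub_left (hi _ _) (hi _ _)]
  rw [e]
  exact (intervalIntegral.continuous_parametric_intervalIntegral_of_continuous h
    (by fun_prop)).sub
    (intervalIntegral.continuous_parametric_intervalIntegral_of_continuous h (by fun_prop))

theorem jumpFun_mono (hR : IsFellerRate R) {f g : ℝ × ℝ × E →ᵇ ℝ} (h : f ≤ g) (p : ℝ × ℝ × E) :
    jumpFun R f p ≤ jumpFun R g p := by
  refine intervalIntegral.integral_mono_on (le_max_left _ _)
    ((hR.continuous_jumpIntegrand_right f _ _ _).intervalIntegrable _ _)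
    ((hR.continuous_jumpIntegrand_right g _ _ _).intervalIntegrable _ _) fun r _ => ?_
  gcongr
  · exact hR.sectionIntegrable f _ _ _
  · exact hR.sectionIntegrable g _ _ _
  · exact fun y => h _

theorem jumpFun_add (hR : IsFellerRate R) (f g : ℝ × ℝ × E →ᵇ ℝ) (p : ℝ × ℝ × E) :
    jumpFun R ⇑(f + g) p = jumpFun R f p + jumpFun R g p := by
  unfold jumpFun
  rw [← intervalIntegral.integral_add
    ((hR.continuous_jumpIntegrand_right f _ _ _).intervalIntegrable _ _)
    ((hR.continuous_jumpIntegrand_right g _ _ _).intervalIntegrable _ _)]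
  congr 1 with r
  simp only [BoundedContinuousFunction.coe_add, Pi.add_apply]
  rw [integral_add (hR.sectionIntegrable f _ _ _) (hR.sectionIntegrable g _ _ _), mul_add]

/-- The probability of at least one jump is one minus the probability of no jump. -/
theorem jumpFun_one (hR : IsFellerRate R) (p : ℝ × ℝ × E) :
    jumpFun R ⇑(1 : ℝ × ℝ × E →ᵇ ℝ) p
      = 1 - Real.exp (-cumIntensity R p.1 (max p.1 p.2.1) p.2.2) := by
  have h := intervalIntegral.integral_eq_sub_of_hasDerivAt (a := p.1) (b := max p.1 p.2.1)
    (fun r _ => (hR.hasDerivAt_exp_neg_cumIntensity p.1 r p.2.2).neg)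
    (by
      have := hR.continuous_jumpIntegrand_right 1 p.1 p.2.1 p.2.2
      simp only [BoundedContinuousFunction.coe_one, Pi.one_apply, integral_const, smul_eq_mul,
        mul_one] at this
      simp only [neg_neg]
      exact this.intervalIntegrable _ _)
  have e : cumIntensity R p.1 p.1 p.2.2 = 0 := intervalIntegral.integral_same
  simp only [neg_neg, Pi.neg_apply, e, neg_zero, Real.exp_zero] at h
  rw [sub_neg_eq_add, neg_add_eq_sub] at h
  rw [← h, jumpFun]
  simp only [BoundedContinuousFunction.coe_one, Pi.one_apply, integral_const, smul_eq_mul, mul_one]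
  rfl

theorem abs_jumpFun_le (hR : IsFellerRate R) (g : ℝ × ℝ × E →ᵇ ℝ) (p : ℝ × ℝ × E) :
    |jumpFun R g p| ≤ ‖g‖ := by
  have h1 : jumpFun R ⇑(1 : ℝ × ℝ × E →ᵇ ℝ) p ≤ 1 := by
    rw [hR.jumpFun_one]; linarith [Real.exp_pos (-cumIntensity R p.1 (max p.1 p.2.1) p.2.2)]
  have hu : g ≤ ‖g‖ • (1 : ℝ × ℝ × E →ᵇ ℝ) := fun q => by
    simpa using (abs_le.1 (g.norm_coe_le_norm q)).2
  have hl : (-‖g‖) • (1 : ℝ × ℝ × E →ᵇ ℝ) ≤ g := fun q => by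
    simpa using (abs_le.1 (g.norm_coe_le_norm q)).1
  have hu' := hR.jumpFun_mono hu p
  have hl' := hR.jumpFun_mono hl p
  rw [jumpFun_smul] at hu' hl'
  have := norm_nonneg g
  rw [abs_le]
  constructor <;> nlinarith

/-- `jumpFun` as a linear operator on bounded continuous functions. -/
noncomputable def jumpOp (hR : IsFellerRate R) : (ℝ × ℝ × E →ᵇ ℝ) →ₗ[ℝ] (ℝ × ℝ × E →ᵇ ℝ) where
  toFun g := BoundedContinuousFunction.ofNormedAddCommGroup (jumpFun R g)
    (hR.continuous_jumpFun g) ‖g‖ (hR.abs_jumpFun_le g)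
  map_add' f g := by ext p; exact hR.jumpFun_add f g p
  map_smul' c f := by ext p; exact jumpFun_smul c f p

theorem jumpOp_apply (hR : IsFellerRate R) (g : ℝ × ℝ × E →ᵇ ℝ) (p : ℝ × ℝ × E) :
    hR.jumpOp g p = jumpFun R g p := rfl

theorem jumpOp_pow_nonneg (hR : IsFellerRate R) {g : ℝ × ℝ × E →ᵇ ℝ} (hg : 0 ≤ g) (n : ℕ) :
    0 ≤ (hR.jumpOp ^ n) g := by
  induction n with
  | zero => simpa using hg
  | succ n ih =>
    rw [pow_succ', Module.End.mul_apply]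
    intro p
    have h := hR.jumpFun_mono ih p
    have h0 := jumpFun_smul (R := R) 0 (0 : ℝ × ℝ × E →ᵇ ℝ) p
    rw [zero_smul, zero_mul] at h0
    rw [h0] at h
    exact h

theorem jumpOp_pow_noJump_nonneg (hR : IsFellerRate R) {F : E →ᵇ ℝ} (hF : 0 ≤ F) (n : ℕ)
    (p : ℝ × ℝ × E) : 0 ≤ (hR.jumpOp ^ n) (hR.noJump F) p :=
  hR.jumpOp_pow_nonneg (hR.noJump_nonneg hF) n p

theorem noJump_one (hR : IsFellerRate R) : hR.noJump 1 = 1 - hR.jumpOp 1 := by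
  ext p
  rw [BoundedContinuousFunction.sub_apply, jumpOp_apply, hR.jumpFun_one, noJump_apply]
  simp

/-- The mass carried by paths with fewer than `N` jumps. -/
theorem sum_jumpOp_pow_noJump_one (hR : IsFellerRate R) (N : ℕ) :
    ∑ n ∈ Finset.range N, (hR.jumpOp ^ n) (hR.noJump 1) = 1 - (hR.jumpOp ^ N) 1 := by
  induction N with
  | zero => simp
  | succ N ih =>
    rw [Finset.sum_range_succ, ih, hR.noJump_one, map_sub, ← Module.End.mul_apply, ← pow_succ]
    abel

theorem jumpOp_pow_one_antitone (hR : IsFellerRate R) (p : ℝ × ℝ × E) :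
    Antitone fun n => (hR.jumpOp ^ n) 1 p := by
  refine antitone_nat_of_succ_le fun n => ?_
  have h := hR.jumpOp_pow_nonneg (hR.noJump_nonneg (F := 1) fun _ => zero_le_one) n p
  rw [hR.noJump_one, map_sub, ← Module.End.mul_apply, ← pow_succ] at h
  simpa using h

end IsFellerRate

end JumpStep
section NonExplosion

variable [MeasurableSpace E] [TopologicalSpace E] [BorelSpace E] [PolishSpace E]
  [LocallyCompactSpace E] {R : ℝ → E → Measure E}

namespace IsFellerRate

/-- Under a Lyapunov condition, the function `a (t - s) V(x) exp(∫_s^t c)` is a supersolution of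
the equation for the expected number of jumps. -/
theorem jumpOp_one_add_le (hR : IsFellerRate R) {V : E → ℝ} {c : ℝ → ℝ} {a t : ℝ}
    (hV : ∀ x, 0 ≤ V x) (hc : Continuous c) (hc0 : ∀ r, 0 ≤ c r) (ha : 0 ≤ a)
    (hVi : ∀ r x, Integrable V (R r x))
    (hVl : ∀ r x, ∫ y, V y ∂(R r x) ≤ (c r + qIntensity R r x) * V x)
    (hq : ∀ r ≤ t, ∀ x, qIntensity R r x ≤ a * V x) {g : ℝ × ℝ × E →ᵇ ℝ}
    (hg : ∀ r ≤ t, ∀ x, g (r, t, x) ≤ a * (t - r) * V x * Real.exp (∫ τ in r..t, c τ))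
    {s : ℝ} (hs : s ≤ t) (x : E) :
    hR.jumpOp (1 + g) (s, t, x) ≤ a * (t - s) * V x * Real.exp (∫ τ in s..t, c τ) := by
  have hC (r : ℝ) : HasDerivAt (fun r => ∫ τ in r..t, c τ) (-c r) r :=
    intervalIntegral.integral_hasDerivAt_left (hc.intervalIntegrable _ _)
      hc.stronglyMeasurable.stronglyMeasurableAtFilter hc.continuousAt
  set D : ℝ → ℝ := fun r => Real.exp (-cumIntensity R s r x) with hD
  set G : ℝ → ℝ := fun r => Real.exp (∫ τ in r..t, c τ) with hG
  have hDd (r : ℝ) : HasDerivAt D (-(D r * qIntensity R r x)) r :=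
    hR.hasDerivAt_exp_neg_cumIntensity s r x
  have hGd (r : ℝ) : HasDerivAt G (G r * -c r) r := (hC r).exp
  have hqc : Continuous fun r => qIntensity R r x :=
    hR.continuous_qIntensity.comp (by fun_prop : Continuous fun r : ℝ => (r, x))
  have hDc : Continuous D := continuous_iff_continuousAt.2 fun r => (hDd r).continuousAt
  have hGc : Continuous G := continuous_iff_continuousAt.2 fun r => (hGd r).continuousAt
  have hd (r : ℝ) : HasDerivAt (fun r => -(a * V x) * ((t - r) * (D r * G r)))
      (a * V x * (D r * G r) * (1 + (t - r) * (c r + qIntensity R r x))) r := by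
    have h := ((((hasDerivAt_id r).const_sub t).mul ((hDd r).mul (hGd r))).const_mul
      (-(a * V x)))
    convert! h using 1
    simp only [id, Pi.mul_apply]
    ring
  have hint := intervalIntegral.integral_eq_sub_of_hasDerivAt (a := s) (b := t)
    (fun r _ => hd r) (Continuous.intervalIntegrable (by fun_prop) _ _)
  have hDs : D s = 1 := by simp [hD, cumIntensity]
  have hend : a * (t - s) * V x * Real.exp (∫ τ in s..t, c τ) =
      ∫ r in s..t, a * V x * (D r * G r) * (1 + (t - r) * (c r + qIntensity R r x)) := by
    rw [hint, hDs]; ring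
  rw [hend, jumpOp_apply, jumpFun]
  simp only [max_eq_right hs]
  refine intervalIntegral.integral_mono_on hs
    ((hR.continuous_jumpIntegrand_right (1 + g) s t x).intervalIntegrable _ _)
    (Continuous.intervalIntegrable (by fun_prop) _ _) fun r hr => ?_
  have := hR.finite r x
  have hGr : 1 ≤ G r :=
    Real.one_le_exp (intervalIntegral.integral_nonneg hr.2 fun τ _ => hc0 τ)
  have hDr : 0 < D r := Real.exp_pos _
  have htr : 0 ≤ t - r := sub_nonneg.2 hr.2
  have hb : ∫ y, (1 + g) (r, t, y) ∂(R r x)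
      ≤ qIntensity R r x + a * (t - r) * G r * ∫ y, V y ∂(R r x) := by
    calc ∫ y, (1 + g) (r, t, y) ∂(R r x)
        ≤ ∫ y, (1 + a * (t - r) * G r * V y) ∂(R r x) := by
          refine integral_mono (hR.sectionIntegrable (1 + g) r t x)
            ((integrable_const _).add ((hVi r x).const_mul _)) fun y => ?_
          have := hg r hr.2 y
          simp only [BoundedContinuousFunction.coe_add, BoundedContinuousFunction.coe_one,
            Pi.add_apply, Pi.one_apply]
          simp only [hG]
          linarith
      _ = _ := by
          rw [integral_add (integrable_const _) ((hVi r x).const_mul _), integral_const_mul,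
            integral_const, smul_eq_mul, mul_one]
          rfl
  have h1 : qIntensity R r x ≤ a * V x * G r :=
    (hq r hr.2 x).trans (le_mul_of_one_le_right (mul_nonneg ha (hV x)) hGr)
  have h2 : a * (t - r) * G r * ∫ y, V y ∂(R r x)
      ≤ a * (t - r) * G r * ((c r + qIntensity R r x) * V x) :=
    mul_le_mul_of_nonneg_left (hVl r x) (by positivity)
  calc D r * ∫ y, (1 + g) (r, t, y) ∂(R r x)
      ≤ D r * (a * V x * G r + a * (t - r) * G r * ((c r + qIntensity R r x) * V x)) := by
        gcongr; linarith
    _ = _ := by ring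

/-- Quantitative non-explosion: Markov's inequality for the number of jumps. -/
theorem mul_jumpOp_pow_one_le (hR : IsFellerRate R) {V : E → ℝ} {c : ℝ → ℝ} {a t : ℝ}
    (hV : ∀ x, 0 ≤ V x) (hc : Continuous c) (hc0 : ∀ r, 0 ≤ c r) (ha : 0 ≤ a)
    (hVi : ∀ r x, Integrable V (R r x))
    (hVl : ∀ r x, ∫ y, V y ∂(R r x) ≤ (c r + qIntensity R r x) * V x)
    (hq : ∀ r ≤ t, ∀ x, qIntensity R r x ≤ a * V x)
    {s : ℝ} (hs : s ≤ t) (x : E) (N : ℕ) :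
    N * (hR.jumpOp ^ N) 1 (s, t, x) ≤ a * (t - s) * V x * Real.exp (∫ τ in s..t, c τ) := by
  have key : ∀ s ≤ t, ∀ x, (∑ k ∈ Finset.range N, (hR.jumpOp ^ (k + 1)) 1) (s, t, x)
      ≤ a * (t - s) * V x * Real.exp (∫ τ in s..t, c τ) := by
    induction N with
    | zero =>
      intro s hs x
      have := sub_nonneg.2 hs
      have := hV x
      simp only [Finset.range_zero, Finset.sum_empty, BoundedContinuousFunction.coe_zero,
        Pi.zero_apply]
      positivity
    | succ N ih =>
      intro s hs x
      have e : ∑ k ∈ Finset.range (N + 1), (hR.jumpOp ^ (k + 1)) 1 =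
          hR.jumpOp (1 + ∑ k ∈ Finset.range N, (hR.jumpOp ^ (k + 1)) 1) := by
        rw [map_add, map_sum, Finset.sum_range_succ', add_comm]
        simp only [zero_add, pow_one, ← Module.End.mul_apply, ← pow_succ']
      rw [e]
      exact hR.jumpOp_one_add_le hV hc hc0 ha hVi hVl hq ih hs x
  refine le_trans ?_ (key s hs x)
  rw [BoundedContinuousFunction.coe_sum, Finset.sum_apply]
  calc (N : ℝ) * (hR.jumpOp ^ N) 1 (s, t, x)
      = ∑ _k ∈ Finset.range N, (hR.jumpOp ^ N) 1 (s, t, x) := by simp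
    _ ≤ _ := Finset.sum_le_sum fun k hk =>
        hR.jumpOp_pow_one_antitone _ (Finset.mem_range.1 hk)

end IsFellerRate

end NonExplosion

section Identification

variable [MeasurableSpace E] [TopologicalSpace E] [BorelSpace E] [PolishSpace E]
  [LocallyCompactSpace E] {Q R : ℝ → E → Measure E}

namespace IsFellerRate

theorem lintegral_Piter (hR : IsFellerRate R) (hQR : ∀ t, 0 ≤ t → Q t = R t) (n : ℕ) {s t : ℝ}
    (hs : 0 ≤ s) (hst : s ≤ t) (x : E) {F : E →ᵇ ℝ} (hF : 0 ≤ F) :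
    ∫⁻ y, ENNReal.ofReal (F y) ∂(Piter Q n s t x) =
      ENNReal.ofReal ((hR.jumpOp ^ n) (hR.noJump F) (s, t, x)) := by
  have hΛ {s r : ℝ} (hs : 0 ≤ s) (hr : s ≤ r) (x : E) :
      ∫ τ in s..r, qIntensity Q τ x = cumIntensity R s r x := by
    refine intervalIntegral.integral_congr fun τ hτ => ?_
    rw [uIcc_of_le hr] at hτ
    simp only [qIntensity, hQR τ (hs.trans hτ.1)]
  induction n generalizing s x F with
  | zero =>
    have hm : Measurable fun y => ENNReal.ofReal (F y) := F.continuous.measurable.ennreal_ofReal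
    rw [Piter, lintegral_smul_measure, lintegral_dirac' _ hm, hΛ hs hst, pow_zero,
      Module.End.one_apply, noJump_apply, max_eq_right hst, mul_comm (F x),
      ENNReal.ofReal_mul (Real.exp_pos _).le]
    rfl
  | succ n ih =>
    have hmeas (r : ℝ) (hr : r ∈ Ioc s t) : Measurable (Piter Q n r t) := by
      have hr0 := hs.trans hr.1.le
      refine measurable_measure_of_lintegral_boundedContinuous (fun y => ⟨?_⟩) fun f hf => ?_
      · have := ih hr0 hr.2 y (F := 1) (fun _ => zero_le_one)
        simp only [BoundedContinuousFunction.coe_one, Pi.one_apply, ENNReal.ofReal_one,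
          lintegral_one] at this
        rw [this]
        exact ENNReal.ofReal_lt_top
      · simp only [fun y => ih hr0 hr.2 y hf]
        have : Continuous fun y => (hR.jumpOp ^ n) (hR.noJump f) (r, t, y) := by fun_prop
        exact this.measurable.ennreal_ofReal
    have hbind (r : ℝ) (hr : r ∈ Ioc s t) (f : E →ᵇ ℝ) (hf : 0 ≤ f) :
        ∫⁻ y, ENNReal.ofReal (f y) ∂(Measure.bind (Q r x) (Piter Q n r t)) =
          ENNReal.ofReal (∫ y, (hR.jumpOp ^ n) (hR.noJump f) (r, t, y) ∂(R r x)) := by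
      have hr0 := hs.trans hr.1.le
      rw [Measure.lintegral_bind (hmeas r hr).aemeasurable
        f.continuous.measurable.ennreal_ofReal.aemeasurable, hQR r hr0,
        ofReal_integral_eq_lintegral_ofReal (hR.sectionIntegrable _ _ _ _)
          (.of_forall fun y => hR.jumpOp_pow_noJump_nonneg hf n _)]
      exact lintegral_congr fun y => ih hr0 hr.2 y hf
    have hcont (f : E →ᵇ ℝ) :
        Continuous fun r => ∫ y, (hR.jumpOp ^ n) (hR.noJump f) (r, t, y) ∂(R r x) :=
      continuous_integral_of_weaklyContinuous (fun r => hR.finite r x)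
        (fun f => (hR.continuous_integral f).comp (by fun_prop : Continuous fun r : ℝ => (r, x)))
        (((hR.jumpOp ^ n) (hR.noJump f)).compContinuous
          ⟨fun z : ℝ × E => (z.1, t, z.2), by fun_prop⟩)
    have hae : AEMeasurable (fun r => Measure.bind (Q r x) (Piter Q n r t))
        (volume.restrict (Ioc s t)) := by
      classical
      refine ⟨fun r => if r ∈ Ioc s t then Measure.bind (Q r x) (Piter Q n r t) else 0, ?_, ?_⟩
      · refine measurable_measure_of_lintegral_boundedContinuous (fun r => ?_) fun f hf => ?_
        · split_ifs with hr
          · refine ⟨?_⟩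
            have := hbind r hr 1 (fun _ => zero_le_one)
            simp only [BoundedContinuousFunction.coe_one, Pi.one_apply, ENNReal.ofReal_one,
              lintegral_one] at this
            rw [this]
            exact ENNReal.ofReal_lt_top
          · infer_instance
        · have e : (fun r => ∫⁻ y, ENNReal.ofReal (f y)
              ∂(if r ∈ Ioc s t then Measure.bind (Q r x) (Piter Q n r t) else 0)) =
              (Ioc s t).indicator fun r =>
                ENNReal.ofReal (∫ y, (hR.jumpOp ^ n) (hR.noJump f) (r, t, y) ∂(R r x)) := by
            funext r
            by_cases hr : r ∈ Ioc s t
            · simp only [hr, if_true, indicator_of_mem, hbind r hr f hf]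
            · simp only [hr, if_false, lintegral_zero_measure, not_false_eq_true,
                indicator_of_notMem]
          rw [e]
          exact (hcont f).measurable.ennreal_ofReal.indicator measurableSet_Ioc
      · filter_upwards [ae_restrict_mem measurableSet_Ioc] with r hr
        simp only [hr, if_true]
    have hdens : (volume.restrict (Ioc s t)).withDensity (fun r =>
          ENNReal.ofReal (Real.exp (-∫ τ in s..r, qIntensity Q τ x))) =
        (volume.restrict (Ioc s t)).withDensity (fun r =>
          ENNReal.ofReal (Real.exp (-cumIntensity R s r x))) := by
      refine withDensity_congr_ae ?_
      filter_upwards [ae_restrict_mem measurableSet_Ioc] with r hr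
      rw [hΛ hs hr.1.le]
    have hexp : Continuous fun r => Real.exp (-cumIntensity R s r x) :=
      continuous_iff_continuousAt.2 fun r =>
        (hR.hasDerivAt_exp_neg_cumIntensity s r x).continuousAt
    have hprod := hR.continuous_jumpIntegrand_right ((hR.jumpOp ^ n) (hR.noJump F)) s t x
    rw [Piter, hdens, Measure.lintegral_bind
      (hae.mono_ac (withDensity_absolutelyContinuous _ _))
      F.continuous.measurable.ennreal_ofReal.aemeasurable]
    have hcongr : ∀ᵐ r ∂((volume.restrict (Ioc s t)).withDensity fun r =>
          ENNReal.ofReal (Real.exp (-cumIntensity R s r x))),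
        ∫⁻ y, ENNReal.ofReal (F y) ∂(Measure.bind (Q r x) fun y => Piter Q n r t y) =
          ENNReal.ofReal (∫ y, (hR.jumpOp ^ n) (hR.noJump F) (r, t, y) ∂(R r x)) := by
      refine (withDensity_absolutelyContinuous _ _).ae_le ?_
      filter_upwards [ae_restrict_mem measurableSet_Ioc] with r hr using hbind r hr F hF
    rw [lintegral_congr_ae hcongr, lintegral_withDensity_eq_lintegral_mul _
      hexp.measurable.ennreal_ofReal (hcont F).measurable.ennreal_ofReal, pow_succ',
      Module.End.mul_apply, jumpOp_apply, jumpFun]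
    simp only [max_eq_right hst]
    rw [intervalIntegral.integral_of_le hst, ofReal_integral_eq_lintegral_ofReal
      (hprod.integrableOn_Ioc) (.of_forall fun r => mul_nonneg (Real.exp_pos _).le
        (integral_nonneg fun y => hR.jumpOp_pow_noJump_nonneg hF n _))]
    refine lintegral_congr fun r => ?_
    rw [Pi.mul_apply, ENNReal.ofReal_mul (Real.exp_pos _).le]

theorem jumpOp_pow_noJump_le (hR : IsFellerRate R) (F : E →ᵇ ℝ) (n : ℕ) (p : ℝ × ℝ × E) :
    (hR.jumpOp ^ n) (hR.noJump F) p ≤ ‖F‖ * (hR.jumpOp ^ n) (hR.noJump 1) p := by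
  have h0 : 0 ≤ ‖F‖ • hR.noJump 1 - hR.noJump F := fun q => by
    have := mul_nonneg (sub_nonneg.2 (abs_le.1 (F.norm_coe_le_norm q.2.2)).2)
      (Real.exp_pos (-cumIntensity R q.1 (max q.1 q.2.1) q.2.2)).le
    change 0 ≤ ‖F‖ * (1 * Real.exp (-cumIntensity R q.1 (max q.1 q.2.1) q.2.2)) -
      F q.2.2 * Real.exp (-cumIntensity R q.1 (max q.1 q.2.1) q.2.2)
    linarith
  have h := hR.jumpOp_pow_nonneg h0 n p
  rw [map_sub, map_smul] at h
  simpa using h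

theorem sum_range_jumpOp_pow_noJump_le (hR : IsFellerRate R) (F : E →ᵇ ℝ) (N k : ℕ)
    (p : ℝ × ℝ × E) :
    ∑ n ∈ Finset.range (N + k), (hR.jumpOp ^ n) (hR.noJump F) p ≤
      ∑ n ∈ Finset.range N, (hR.jumpOp ^ n) (hR.noJump F) p + ‖F‖ * (hR.jumpOp ^ N) 1 p := by
  have hone (m : ℕ) : ∑ n ∈ Finset.range m, (hR.jumpOp ^ n) (hR.noJump 1) p =
      1 - (hR.jumpOp ^ m) 1 p := by
    have := DFunLike.congr_fun (hR.sum_jumpOp_pow_noJump_one m) p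
    rwa [BoundedContinuousFunction.coe_sum, Finset.sum_apply] at this
  have h1 := hone (N + k)
  rw [Finset.sum_range_add, hone N] at h1
  have h2 : 0 ≤ (hR.jumpOp ^ (N + k)) 1 p :=
    hR.jumpOp_pow_nonneg (g := 1) (fun _ => zero_le_one) _ p
  rw [Finset.sum_range_add]
  gcongr
  calc ∑ i ∈ Finset.range k, (hR.jumpOp ^ (N + i)) (hR.noJump F) p
      ≤ ∑ i ∈ Finset.range k, ‖F‖ * (hR.jumpOp ^ (N + i)) (hR.noJump 1) p :=
        Finset.sum_le_sum fun i _ => hR.jumpOp_pow_noJump_le F _ p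
    _ ≤ ‖F‖ * (hR.jumpOp ^ N) 1 p := by
        rw [← Finset.mul_sum]
        gcongr
        linarith

theorem summable_jumpOp_pow_noJump (hR : IsFellerRate R) {F : E →ᵇ ℝ} (hF : 0 ≤ F)
    (p : ℝ × ℝ × E) : Summable fun n => (hR.jumpOp ^ n) (hR.noJump F) p := by
  refine summable_of_sum_range_le (c := ‖F‖)
    (fun n => hR.jumpOp_pow_noJump_nonneg hF n p) fun n => ?_
  simpa using hR.sum_range_jumpOp_pow_noJump_le F 0 n p

theorem lintegral_Pmin (hR : IsFellerRate R) (hQR : ∀ t, 0 ≤ t → Q t = R t) {s t : ℝ}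
    (hs : 0 ≤ s) (hst : s ≤ t) (x : E) {F : E →ᵇ ℝ} (hF : 0 ≤ F) :
    ∫⁻ y, ENNReal.ofReal (F y) ∂(Pmin Q s t x) =
      ENNReal.ofReal (∑' n, (hR.jumpOp ^ n) (hR.noJump F) (s, t, x)) := by
  rw [Pmin, lintegral_sum_measure, ENNReal.ofReal_tsum_of_nonneg
    (fun n => hR.jumpOp_pow_noJump_nonneg hF n _)
    (hR.summable_jumpOp_pow_noJump hF _)]
  exact tsum_congr fun n => hR.lintegral_Piter hQR n hs hst x hF

theorem isFiniteMeasure_Pmin (hR : IsFellerRate R) (hQR : ∀ t, 0 ≤ t → Q t = R t) {s t : ℝ}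
    (hs : 0 ≤ s) (hst : s ≤ t) (x : E) : IsFiniteMeasure (Pmin Q s t x) := by
  have := hR.lintegral_Pmin hQR hs hst x (F := 1) (fun _ => zero_le_one)
  simp only [BoundedContinuousFunction.coe_one, Pi.one_apply, ENNReal.ofReal_one,
    lintegral_one] at this
  exact ⟨this ▸ ENNReal.ofReal_lt_top⟩

theorem Umin_eq_tsum (hR : IsFellerRate R) (hQR : ∀ t, 0 ≤ t → Q t = R t) {s t : ℝ}
    (hs : 0 ≤ s) (hst : s ≤ t) (x : E) {F : E →ᵇ ℝ} (hF : 0 ≤ F) :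
    Umin Q s t F x = ∑' n, (hR.jumpOp ^ n) (hR.noJump F) (s, t, x) := by
  rw [Umin, integral_eq_lintegral_of_nonneg_ae (f := ⇑F) (.of_forall hF)
    F.continuous.aestronglyMeasurable, hR.lintegral_Pmin hQR hs hst x hF, ENNReal.toReal_ofReal
    (tsum_nonneg fun n => hR.jumpOp_pow_noJump_nonneg hF n _)]

/-- The truncation of the series for `U(s,t)F` after `N` terms costs at most `‖F‖` times the
probability of at least `N` jumps. -/
theorem abs_Umin_sub_sum_le (hR : IsFellerRate R) (hQR : ∀ t, 0 ≤ t → Q t = R t) {s t : ℝ}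
    (hs : 0 ≤ s) (hst : s ≤ t) (x : E) {F : E →ᵇ ℝ} (hF : 0 ≤ F) (N : ℕ) :
    |Umin Q s t F x - ∑ n ∈ Finset.range N, (hR.jumpOp ^ n) (hR.noJump F) (s, t, x)| ≤
      ‖F‖ * (hR.jumpOp ^ N) 1 (s, t, x) := by
  have hsum := hR.summable_jumpOp_pow_noJump hF (s, t, x)
  rw [hR.Umin_eq_tsum hQR hs hst x hF, abs_of_nonneg (sub_nonneg.2 (hsum.sum_le_tsum _
    fun n _ => hR.jumpOp_pow_noJump_nonneg hF n _)), sub_le_iff_le_add']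
  refine le_of_tendsto ((tendsto_add_atTop_iff_nat N).2 hsum.hasSum.tendsto_sum_nat)
    (.of_forall fun k => ?_)
  rw [add_comm k N]
  exact hR.sum_range_jumpOp_pow_noJump_le F N k (s, t, x)

end IsFellerRate

end Identification
section StandingHypotheses

variable [MeasurableSpace E] [TopologicalSpace E] {Q : ℝ → E → Measure E}
  {V : E → ℝ} {c : ℝ → ℝ}

/-- Freezing the rates at negative times yields a weakly continuous family on the whole line. -/
theorem StandingHypotheses.isFellerRate (hQ : IsTransitionFunction Q)
    (hH : StandingHypotheses Q V c) : IsFellerRate fun t => Q (max t 0) where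
  finite t x := hQ.1 _ x (le_max_right _ _)
  continuous_integral f := by
    refine (hH.weak_cont f f.continuous ⟨‖f‖, fun x => ?_⟩).comp_continuous
      (by fun_prop : Continuous fun p : ℝ × E => (max p.1 0, p.2))
      fun p => show (0 : ℝ) ≤ max p.1 0 from le_max_right _ _
    exact (f.norm_coe_le_norm x).trans
      (le_mul_of_one_le_right (norm_nonneg _) (by linarith [hH.V_nonneg x]))

variable [BorelSpace E]

theorem StandingHypotheses.integrable_lyapunov (hH : StandingHypotheses Q V c) {t : ℝ}
    (ht : 0 ≤ t) (x : E) : Integrable V (Q t x) := by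
  refine ⟨hH.V_cont.aestronglyMeasurable, ?_⟩
  rw [hasFiniteIntegral_iff_ofReal (.of_forall hH.V_nonneg)]
  exact (hH.lyapunov t ht x).trans_lt ENNReal.ofReal_lt_top

theorem StandingHypotheses.integral_lyapunov_le (hH : StandingHypotheses Q V c) {t : ℝ}
    (ht : 0 ≤ t) (x : E) : ∫ y, V y ∂(Q t x) ≤ (c t + qIntensity Q t x) * V x := by
  have hq : 0 ≤ qIntensity Q t x := ENNReal.toReal_nonneg
  have := hH.V_nonneg x
  have := hH.c_nonneg t
  rw [integral_eq_lintegral_of_nonneg_ae (.of_forall hH.V_nonneg)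
    hH.V_cont.aestronglyMeasurable, add_mul]
  exact ENNReal.toReal_le_of_le_ofReal (by positivity) (hH.lyapunov t ht x)

/-- The Feller property for nonnegative bounded continuous functions. -/
theorem StandingHypotheses.continuousOn_Umin_of_nonneg [PolishSpace E] [LocallyCompactSpace E]
    (hQ : IsTransitionFunction Q) (hH : StandingHypotheses Q V c) {F : E →ᵇ ℝ} (hF : 0 ≤ F) :
    ContinuousOn (fun p : (ℝ × ℝ) × E => Umin Q p.1.1 p.1.2 F p.2)
      {p : (ℝ × ℝ) × E | 0 ≤ p.1.1 ∧ p.1.1 ≤ p.1.2} := by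
  have hR := hH.isFellerRate hQ
  have hQR (t : ℝ) (ht : 0 ≤ t) : Q t = Q (max t 0) := by rw [max_eq_left ht]
  have hcc : Continuous fun r => c (max r 0) := hH.c_cont.comp (by fun_prop)
  have hcint : Continuous fun p : ℝ × ℝ => ∫ τ in p.1..p.2, c (max τ 0) := by
    have hu : Continuous (Function.uncurry fun (_ : ℝ × ℝ) r => c (max r 0)) :=
      hcc.comp continuous_snd
    have e : (fun p : ℝ × ℝ => ∫ τ in p.1..p.2, c (max τ 0)) =
        fun p => (∫ τ in (0 : ℝ)..p.2, c (max τ 0)) - ∫ τ in (0 : ℝ)..p.1, c (max τ 0) := by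
      funext p
      rw [intervalIntegral.integral_interval_sub_left (hcc.intervalIntegrable _ _)
        (hcc.intervalIntegrable _ _)]
    rw [e]
    exact (intervalIntegral.continuous_parametric_intervalIntegral_of_continuous hu
      continuous_snd).sub
      (intervalIntegral.continuous_parametric_intervalIntegral_of_continuous hu continuous_fst)
  refine continuousOn_of_locally_uniform_approx_of_continuousWithinAt fun p₀ hp₀ u hu => ?_
  obtain ⟨ε, hε, hεu⟩ := Metric.mem_uniformity_dist.1 hu
  have hT : 0 < p₀.1.2 + 1 := by linarith [hp₀.1.trans hp₀.2]
  obtain ⟨a, ha, haq⟩ := hH.q_bound (p₀.1.2 + 1) hT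
  set W : (ℝ × ℝ) × E → ℝ := fun p =>
    a * (p.1.2 - p.1.1) * V p.2 * Real.exp (∫ τ in p.1.1..p.1.2, c (max τ 0)) with hW
  have hWc : Continuous W := by
    have h1 : Continuous fun p : (ℝ × ℝ) × E => V p.2 := hH.V_cont.comp continuous_snd
    have h2 : Continuous fun p : (ℝ × ℝ) × E => ∫ τ in p.1.1..p.1.2, c (max τ 0) :=
      hcint.comp continuous_fst
    exact ((by fun_prop : Continuous fun p : (ℝ × ℝ) × E => a * (p.1.2 - p.1.1)).mul h1).mul
      (Real.continuous_exp.comp h2)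
  obtain ⟨N, hN⟩ := exists_nat_gt (‖F‖ * (W p₀ + 1) / ε)
  rw [div_lt_iff₀ hε] at hN
  have h1 : ∀ᶠ p in 𝓝 p₀, W p < W p₀ + 1 :=
    hWc.continuousAt.eventually (gt_mem_nhds (by linarith))
  have h2 : ∀ᶠ p in 𝓝 p₀, p.1.2 < p₀.1.2 + 1 :=
    (by fun_prop : Continuous fun p : (ℝ × ℝ) × E => p.1.2).continuousAt.eventually
      (gt_mem_nhds (by linarith))
  refine ⟨_, inter_mem self_mem_nhdsWithin (mem_nhdsWithin_of_mem_nhds (h1.and h2)),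
    fun p => ∑ n ∈ Finset.range N, (hR.jumpOp ^ n) (hR.noJump F) (p.1.1, p.1.2, p.2),
    Continuous.continuousWithinAt (by fun_prop), ?_⟩
  rintro p ⟨⟨hp0, hp⟩, hpW, hpT⟩
  apply hεu
  rw [Real.dist_eq]
  refine (hR.abs_Umin_sub_sum_le hQR hp0 hp p.2 hF N).trans_lt ?_
  have hb : N * (hR.jumpOp ^ N) 1 (p.1.1, p.1.2, p.2) ≤ W p :=
    hR.mul_jumpOp_pow_one_le hH.V_nonneg hcc (fun r => hH.c_nonneg _) ha.le
      (fun r x => hH.integrable_lyapunov (le_max_right r 0) x)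
      (fun r x => hH.integral_lyapunov_le (le_max_right r 0) x)
      (fun r hr x => haq _ ⟨le_max_right r 0, max_le (hr.trans hpT.le) hT.le⟩ x) hp p.2 N
  have hW0 : 0 ≤ W p₀ := by
    have := sub_nonneg.2 hp₀.2
    have := hH.V_nonneg p₀.2
    simp only [hW]
    positivity
  have hN0 : (0 : ℝ) < N := by
    have : 0 ≤ ‖F‖ * (W p₀ + 1) := by positivity
    exact pos_of_mul_pos_left (this.trans_lt hN) hε.le
  refine lt_of_mul_lt_mul_left ?_ hN0.le
  calc N * (‖F‖ * (hR.jumpOp ^ N) 1 (p.1.1, p.1.2, p.2))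
      = ‖F‖ * (N * (hR.jumpOp ^ N) 1 (p.1.1, p.1.2, p.2)) := by ring
    _ ≤ ‖F‖ * (W p₀ + 1) := by gcongr; linarith
    _ < N * ε := hN

end StandingHypotheses

/-- Under the standing hypotheses (H), for every bounded continuous
`F : E → ℝ` the map `(s,t,x) ↦ U(s,t)F(x) = ∫_E F(y) P(s,x;t,dy)` is continuous on
`{(s,t) : 0 ≤ s ≤ t} × E`, i.e. `U(s,t)` is a Feller evolution system. -/
theorem feller_evolution [MeasurableSpace E] [TopologicalSpace E] [BorelSpace E]
    [PolishSpace E] [LocallyCompactSpace E]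
    (Q : ℝ → E → Measure E) (V : E → ℝ) (c : ℝ → ℝ)
    (hQ : IsTransitionFunction Q) (hH : StandingHypotheses Q V c)
    (F : E → ℝ) (hFc : Continuous F) (hFb : ∃ M : ℝ, ∀ x, |F x| ≤ M) :
    ContinuousOn (fun p : (ℝ × ℝ) × E => Umin Q p.1.1 p.1.2 F p.2)
      {p : (ℝ × ℝ) × E | 0 ≤ p.1.1 ∧ p.1.1 ≤ p.1.2} := by
  obtain ⟨M, hM⟩ := hFb
  let G : E →ᵇ ℝ := BoundedContinuousFunction.ofNormedAddCommGroup F hFc M hM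
  have hG (x) : G x = F x := rfl
  have hpos : 0 ≤ G + ‖G‖ • 1 := fun x => by
    have := (abs_le.1 (G.norm_coe_le_norm x)).1
    change 0 ≤ G x + ‖G‖ * 1
    linarith
  refine ((hH.continuousOn_Umin_of_nonneg hQ hpos).sub
    ((hH.continuousOn_Umin_of_nonneg hQ (F := 1) fun _ => zero_le_one).const_smul ‖G‖)).congr ?_
  rintro ⟨⟨s, t⟩, x⟩ ⟨hs, hst⟩
  have : IsFiniteMeasure (Pmin Q s t x) := (hH.isFellerRate hQ).isFiniteMeasure_Pmin
    (fun t ht => by rw [max_eq_left ht]) hs hst x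
  change ∫ y, F y ∂(Pmin Q s t x) =
    ∫ y, (G y + ‖G‖ * 1) ∂(Pmin Q s t x) - ‖G‖ * ∫ y, (1 : ℝ) ∂(Pmin Q s t x)
  rw [integral_add (G.integrable _) (integrable_const _)]
  simp [mul_comm, hG]
end

section
/- Let E be a locally compact Polish space and Q a transition function satisfying the standing hypotheses (H). Then the minimal transition function P is conservative: P(s,x;t,E) = 1 for all 0 ≤ s ≤ t and all x ∈ E. -/
open MeasureTheory Set

variable {E : Type*}

open scoped ENNReal
open Filter Topology

/-- The probability of no jump during `(s, r]` when staying at `x`. -/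
noncomputable def holdingWeight [MeasurableSpace E] (Q : ℝ → E → Measure E) (s r : ℝ) (x : E) :
    ℝ≥0∞ :=
  ENNReal.ofReal (Real.exp (-∫ τ in s..r, qIntensity Q τ x))

/-- The first-jump operator `u ↦ ∫_s^t e^{-∫_s^r q(τ,x)dτ} ∫_E u(r,y) Q(r,x,dy) dr`. -/
noncomputable def jumpOperator [MeasurableSpace E] (Q : ℝ → E → Measure E) (t : ℝ)
    (u : ℝ → E → ℝ≥0∞) (s : ℝ) (x : E) : ℝ≥0∞ :=
  ∫⁻ r in Ioc s t, holdingWeight Q s r x * ∫⁻ y, u r y ∂(Q r x)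

/-- The probability of at least `n` jumps during `(s, t]`. -/
noncomputable def jumpTail [MeasurableSpace E] (Q : ℝ → E → Measure E) (t : ℝ) :
    ℕ → ℝ → E → ℝ≥0∞
  | 0 => fun _ _ => 1
  | n + 1 => jumpOperator Q t (jumpTail Q t n)

lemma lintegral_Ioc_ofReal_deriv {G G' : ℝ → ℝ} {s t : ℝ} (hst : s ≤ t)
    (hG : ∀ r, HasDerivAt G (G' r) r) (hG' : Continuous G') (hnn : ∀ r, s ≤ r → 0 ≤ G' r) :
    ∫⁻ r in Ioc s t, ENNReal.ofReal (G' r) = ENNReal.ofReal (G t - G s) := by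
  rw [← intervalIntegral.integral_eq_sub_of_hasDerivAt (fun r _ => hG r)
    (hG'.intervalIntegrable s t), intervalIntegral.integral_of_le hst,
    ofReal_integral_eq_lintegral_ofReal]
  · exact (hG'.intervalIntegrable s t).1
  · filter_upwards [ae_restrict_mem measurableSet_Ioc] with r hr using hnn r hr.1.le

section Measurability

variable [MeasurableSpace E] {Q : ℝ → E → Measure E}

lemma measurable_lintegral_family {α β : Type*} [MeasurableSpace α] [MeasurableSpace β]
    {κ : α → Measure β} (hfin : ∀ a, IsFiniteMeasure (κ a)) (hκ : Measurable κ)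
    {u : α → β → ℝ≥0∞}
    (hu : Measurable fun p : α × β => u p.1 p.2) :
    Measurable fun a => ∫⁻ b, u a b ∂(κ a) := by
  have hmass : Measurable fun a => κ a univ := (Measure.measurable_coe MeasurableSet.univ).comp hκ
  let η : ProbabilityTheory.Kernel α β :=
    { toFun := fun a => (κ a univ)⁻¹ • κ a
      measurable' := by
        refine Measure.measurable_of_measurable_coe _ fun A hA => ?_
        simp only [Measure.smul_apply, smul_eq_mul]
        exact hmass.inv.mul ((Measure.measurable_coe hA).comp hκ) }
  have hη : ∀ a, η a = (κ a univ)⁻¹ • κ a := fun a => rfl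
  have : ProbabilityTheory.IsFiniteKernel η := by
    refine ⟨1, ENNReal.one_lt_top, fun a => ?_⟩
    rw [hη, Measure.smul_apply, smul_eq_mul]
    exact ENNReal.inv_mul_le_one _
  have h : (fun a => ∫⁻ b, u a b ∂(κ a)) = fun a => κ a univ * ∫⁻ b, u a b ∂(η a) := by
    funext a
    rw [hη, lintegral_smul_measure, smul_eq_mul, ← mul_assoc]
    rcases eq_or_ne (κ a univ) 0 with h0 | h0
    · rw [Measure.measure_univ_eq_zero.mp h0]; simp
    · have := hfin a
      rw [ENNReal.mul_inv_cancel h0 (measure_ne_top _ _), one_mul]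
  rw [h]
  exact hmass.mul (Measurable.lintegral_kernel_prod_right (κ := η) (f := u) hu)

lemma measurable_qIntensity (hQ : Measurable fun p : ℝ × E => Q p.1 p.2) :
    Measurable fun p : ℝ × E => qIntensity Q p.1 p.2 :=
  ((Measure.measurable_coe MeasurableSet.univ).comp hQ).ennreal_toReal

lemma measurable_holdingWeight (hQ : Measurable fun p : ℝ × E => Q p.1 p.2) :
    Measurable fun p : (ℝ × E) × ℝ => holdingWeight Q p.1.1 p.2 p.1.2 := by
  have hq := measurable_qIntensity hQ
  have key : ∀ f g : (ℝ × E) × ℝ → ℝ, Measurable f → Measurable g →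
      Measurable fun p : (ℝ × E) × ℝ => ∫ τ in Ioc (f p) (g p), qIntensity Q τ p.1.2 := by
    intro f g hf hg
    have hS : MeasurableSet {z : ((ℝ × E) × ℝ) × ℝ | f z.1 < z.2 ∧ z.2 ≤ g z.1} :=
      (measurableSet_lt (hf.comp measurable_fst) measurable_snd).inter
        (measurableSet_le measurable_snd (hg.comp measurable_fst))
    have hm : Measurable fun z : ((ℝ × E) × ℝ) × ℝ => qIntensity Q z.2 z.1.1.2 :=
      hq.comp (measurable_snd.prodMk measurable_fst.fst.snd)
    have := (hm.indicator hS).stronglyMeasurable.integral_prod_right' (ν := volume)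
    convert this.measurable using 2 with p
    rw [← integral_indicator measurableSet_Ioc]
    rfl
  unfold holdingWeight intervalIntegral
  exact ((key _ _ measurable_fst.fst measurable_snd).sub
    (key _ _ measurable_snd measurable_fst.fst)).neg.exp.ennreal_ofReal

lemma measurable_holdingWeight_right (hQ : Measurable fun p : ℝ × E => Q p.1 p.2) (s : ℝ) (x : E) :
    Measurable fun r => holdingWeight Q s r x :=
  Measurable.comp (g := fun p : (ℝ × E) × ℝ => holdingWeight Q p.1.1 p.2 p.1.2)
    (f := fun r => ((s, x), r)) (measurable_holdingWeight hQ) measurable_prodMk_left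

lemma measurable_jumpOperator (hfin : ∀ r x, IsFiniteMeasure (Q r x))
    (hQ : Measurable fun p : ℝ × E => Q p.1 p.2) (t : ℝ) {u : ℝ → E → ℝ≥0∞}
    (hu : Measurable fun p : ℝ × E => u p.1 p.2) :
    Measurable fun p : ℝ × E => jumpOperator Q t u p.1 p.2 := by
  have hI : Measurable fun p : ℝ × E => ∫⁻ y, u p.1 y ∂(Q p.1 p.2) :=
    measurable_lintegral_family (κ := fun p : ℝ × E => Q p.1 p.2) (u := fun p y => u p.1 y)
      (fun p => hfin p.1 p.2) hQ
      (hu.comp (measurable_fst.fst.prodMk measurable_snd))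
  have hS : MeasurableSet {z : (ℝ × E) × ℝ | z.1.1 < z.2 ∧ z.2 ≤ t} :=
    (measurableSet_lt measurable_fst.fst measurable_snd).inter
      (measurableSet_le measurable_snd measurable_const)
  have hm : Measurable fun z : (ℝ × E) × ℝ =>
      holdingWeight Q z.1.1 z.2 z.1.2 * ∫⁻ y, u z.2 y ∂(Q z.2 z.1.2) :=
    (measurable_holdingWeight hQ).mul (hI.comp (measurable_snd.prodMk measurable_fst.snd))
  have := (hm.indicator hS).lintegral_prod_right' (ν := volume)
  convert this using 2 with p
  rw [jumpOperator, ← lintegral_indicator measurableSet_Ioc]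
  rfl

lemma measurable_Piter_and_apply_succ (hfin : ∀ r x, IsFiniteMeasure (Q r x))
    (hQ : Measurable fun p : ℝ × E => Q p.1 p.2) (t : ℝ) (n : ℕ) :
    (Measurable fun p : ℝ × E => Piter Q n p.1 t p.2) ∧
    ∀ A, MeasurableSet A → ∀ s x,
      Piter Q (n + 1) s t x A = jumpOperator Q t (fun r y => Piter Q n r t y A) s x := by
  have step : ∀ n, (Measurable fun p : ℝ × E => Piter Q n p.1 t p.2) → ∀ A, MeasurableSet A →
      ∀ s x, Piter Q (n + 1) s t x A = jumpOperator Q t (fun r y => Piter Q n r t y A) s x := by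
    intro n hn A hA s x
    have hy : ∀ r, Measurable fun y => Piter Q n r t y := fun r =>
      hn.comp (measurable_const.prodMk measurable_id)
    have hb : ∀ B, MeasurableSet B → Measurable fun r =>
        ∫⁻ y, Piter Q n r t y B ∂(Q r x) := by
      intro B hB
      exact measurable_lintegral_family (κ := fun r => Q r x)
        (u := fun r y => Piter Q n r t y B) (fun r => hfin r x)
        (hQ.comp (measurable_id.prodMk measurable_const))
        ((Measure.measurable_coe hB).comp hn)
    have hr : Measurable fun r => Measure.bind (Q r x) fun y => Piter Q n r t y := by
      refine Measure.measurable_of_measurable_coe _ fun B hB => ?_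
      simp_rw [Measure.bind_apply hB (hy _).aemeasurable]
      exact hb B hB
    rw [Piter, Measure.bind_apply hA hr.aemeasurable]
    simp_rw [Measure.bind_apply hA (hy _).aemeasurable]
    exact lintegral_withDensity_eq_lintegral_mul _
      (measurable_holdingWeight_right hQ s x) (hb A hA)
  have meas : Measurable fun p : ℝ × E => Piter Q n p.1 t p.2 := by
    induction n with
    | zero =>
      refine Measure.measurable_of_measurable_coe _ fun A hA => ?_
      have h0 : Measurable fun p : ℝ × E => holdingWeight Q p.1 t p.2 :=
        Measurable.comp (g := fun p : (ℝ × E) × ℝ => holdingWeight Q p.1.1 p.2 p.1.2)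
          (f := fun p => (p, t)) (measurable_holdingWeight hQ) measurable_prodMk_right
      have h1 : Measurable fun p : ℝ × E => Measure.dirac p.2 A :=
        (Measure.measurable_coe hA).comp (Measure.measurable_dirac.comp measurable_snd)
      exact h0.mul h1
    | succ n ih =>
      refine Measure.measurable_of_measurable_coe _ fun A hA => ?_
      have hA' := measurable_jumpOperator (u := fun r y => Piter Q n r t y A) hfin hQ t
        ((Measure.measurable_coe hA).comp ih)
      have hEq : (fun p : ℝ × E => Piter Q (n + 1) p.1 t p.2 A) =
          fun p => jumpOperator Q t (fun r y => Piter Q n r t y A) p.1 p.2 :=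
        funext fun p => step n ih A hA p.1 p.2
      rw [hEq]
      exact hA'
  exact ⟨meas, step n meas⟩

end Measurability

lemma jumpOperator_add [MeasurableSpace E] {Q : ℝ → E → Measure E}
    (hfin : ∀ r x, IsFiniteMeasure (Q r x)) (hQ : Measurable fun p : ℝ × E => Q p.1 p.2)
    (t : ℝ) {u : ℝ → E → ℝ≥0∞} (hu : Measurable fun p : ℝ × E => u p.1 p.2) (v : ℝ → E → ℝ≥0∞)
    (s : ℝ) (x : E) :
    jumpOperator Q t (fun r y => u r y + v r y) s x =
      jumpOperator Q t u s x + jumpOperator Q t v s x := by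
  have hI : Measurable fun r => ∫⁻ y, u r y ∂(Q r x) :=
    measurable_lintegral_family (κ := fun r => Q r x) (fun r => hfin r x)
      (hQ.comp (measurable_id.prodMk measurable_const)) hu
  have h : ∀ r, ∫⁻ y, (u r y + v r y) ∂(Q r x) = ∫⁻ y, u r y ∂(Q r x) + ∫⁻ y, v r y ∂(Q r x) :=
    fun r => lintegral_add_left (hu.comp (measurable_const.prodMk measurable_id)) _
  unfold jumpOperator
  simp_rw [h, mul_add]
  exact lintegral_add_left ((measurable_holdingWeight_right hQ s x).mul hI) _

lemma jumpOperator_mono [MeasurableSpace E] {Q : ℝ → E → Measure E} {t : ℝ}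
    {u v : ℝ → E → ℝ≥0∞} {s : ℝ} (h : ∀ r, s ≤ r → r ≤ t → ∀ y, u r y ≤ v r y) (x : E) :
    jumpOperator Q t u s x ≤ jumpOperator Q t v s x := by
  refine setLIntegral_mono' measurableSet_Ioc fun r hr => ?_
  gcongr with y
  exact h r hr.1.le hr.2 y

lemma hasDerivAt_exp_neg_integral {q : ℝ → ℝ} (hq : Continuous q) (s r : ℝ) :
    HasDerivAt (fun r => Real.exp (-∫ τ in s..r, q τ))
      (Real.exp (-∫ τ in s..r, q τ) * -q r) r :=
  (hq.integral_hasStrictDerivAt s r).hasDerivAt.neg.exp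

lemma continuous_exp_neg_integral {q : ℝ → ℝ} (hq : Continuous q) (s : ℝ) :
    Continuous fun r => Real.exp (-∫ τ in s..r, q τ) :=
  continuous_iff_continuousAt.2 fun r => (hasDerivAt_exp_neg_integral hq s r).continuousAt

lemma holdingWeight_add_jumpOperator_one [MeasurableSpace E] {Q : ℝ → E → Measure E}
    (hfin : ∀ r x, IsFiniteMeasure (Q r x)) (hq : ∀ x, Continuous fun r => qIntensity Q r x)
    {s t : ℝ} (hst : s ≤ t) (x : E) :
    holdingWeight Q s t x + jumpOperator Q t (fun _ _ => 1) s x = 1 := by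
  have h : jumpOperator Q t (fun _ _ => 1) s x =
      ∫⁻ r in Ioc s t, ENNReal.ofReal
        (Real.exp (-∫ τ in s..r, qIntensity Q τ x) * qIntensity Q r x) := by
    unfold jumpOperator holdingWeight
    congr 1 with r
    have := hfin r x
    rw [lintegral_one, ENNReal.ofReal_mul (Real.exp_pos _).le, qIntensity, ENNReal.ofReal_toReal
      (measure_ne_top _ _)]
  have hd := fun r => (hasDerivAt_exp_neg_integral (hq x) s r).neg
  simp only [mul_neg, neg_neg] at hd
  rw [h, lintegral_Ioc_ofReal_deriv hst hd ((continuous_exp_neg_integral (hq x) s).mul (hq x))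
    fun r _ => mul_nonneg (Real.exp_pos _).le ENNReal.toReal_nonneg, holdingWeight]
  have hle : Real.exp (-∫ τ in s..t, qIntensity Q τ x) ≤ 1 := by
    rw [Real.exp_le_one_iff, neg_nonpos]
    exact intervalIntegral.integral_nonneg hst fun r _ => ENNReal.toReal_nonneg
  rw [← ENNReal.ofReal_add (Real.exp_pos _).le]
  · simp
  · simpa using hle

lemma sum_Piter_add_jumpTail [MeasurableSpace E] {Q : ℝ → E → Measure E}
    (hfin : ∀ r x, IsFiniteMeasure (Q r x)) (hQ : Measurable fun p : ℝ × E => Q p.1 p.2)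
    (hq : ∀ x, Continuous fun r => qIntensity Q r x) (t : ℝ) (n : ℕ) :
    ∀ s, s ≤ t → ∀ x, ∑ k ∈ Finset.range n, Piter Q k s t x univ + jumpTail Q t n s x = 1 := by
  have hm : ∀ k, Measurable fun p : ℝ × E => Piter Q k p.1 t p.2 univ := fun k =>
    (Measure.measurable_coe MeasurableSet.univ).comp (measurable_Piter_and_apply_succ hfin hQ t k).1
  have hsum : ∀ n s x, ∑ k ∈ Finset.range n, Piter Q (k + 1) s t x univ =
      jumpOperator Q t (fun r y => ∑ k ∈ Finset.range n, Piter Q k r t y univ) s x := by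
    intro n s x
    induction n with
    | zero => simp [jumpOperator]
    | succ n ih =>
      simp_rw [Finset.sum_range_succ]
      rw [jumpOperator_add (u := fun r y => ∑ k ∈ Finset.range n, Piter Q k r t y univ) hfin hQ t
          (Finset.measurable_fun_sum _ fun k _ => hm k), ih,
        (measurable_Piter_and_apply_succ hfin hQ t n).2 univ MeasurableSet.univ]
  induction n with
  | zero => intro s _ x; simp [jumpTail]
  | succ n ih =>
    intro s hs x
    have h0 : Piter Q 0 s t x univ = holdingWeight Q s t x := by
      simp [Piter, holdingWeight]
    rw [Finset.sum_range_succ', hsum, h0, jumpTail, add_right_comm,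
      ← jumpOperator_add (u := fun r y => ∑ k ∈ Finset.range n, Piter Q k r t y univ) hfin hQ t
        (Finset.measurable_fun_sum _ fun k _ => hm k), add_comm,
      ← holdingWeight_add_jumpOperator_one hfin hq hs x]
    congr 1
    exact le_antisymm (jumpOperator_mono (fun r _ hr y => (ih r hr y).le) x)
      (jumpOperator_mono (fun r _ hr y => (ih r hr y).ge) x)

/-- A Lyapunov estimate for the jump tail: either the Lyapunov function has exceeded the level `R`,
or the intensity stays below `a * R`, which makes many jumps unlikely. -/
lemma jumpTail_le [MeasurableSpace E] {Q : ℝ → E → Measure E} {V : E → ℝ} {c : ℝ → ℝ}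
    (hfin : ∀ r x, IsFiniteMeasure (Q r x)) (hQ : Measurable fun p : ℝ × E => Q p.1 p.2)
    (hq : ∀ x, Continuous fun r => qIntensity Q r x) (hVm : Measurable V) (hV : ∀ x, 0 ≤ V x)
    (hc : Continuous c) (hc0 : ∀ r, 0 ≤ c r)
    (hlyap : ∀ r x, ∫⁻ y, ENNReal.ofReal (V y) ∂(Q r x)
      ≤ ENNReal.ofReal (c r * V x + qIntensity Q r x * V x))
    {t a R : ℝ} (ha : 0 < a) (hbound : ∀ r, r ≤ t → ∀ x, qIntensity Q r x ≤ a * V x) (hR : 0 < R)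
    (n : ℕ) : ∀ s, s ≤ t → ∀ x, jumpTail Q t n s x ≤
      ENNReal.ofReal (Real.exp (-∫ τ in t..s, c τ) * V x / R
        + (1 / 2) ^ n * Real.exp (2 * a * R * (t - s))) := by
  have hg1 : ∀ s, s ≤ t → 1 ≤ Real.exp (-∫ τ in t..s, c τ) := by
    intro s hs
    rw [Real.one_le_exp_iff, ← intervalIntegral.integral_symm]
    exact intervalIntegral.integral_nonneg hs fun r _ => hc0 r
  induction n with
  | zero =>
    intro s hs x
    rw [jumpTail, ← ENNReal.ofReal_one]
    apply ENNReal.ofReal_le_ofReal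
    have h1 : 0 ≤ Real.exp (-∫ τ in t..s, c τ) * V x / R := by have := hV x; positivity
    have h2 : 1 ≤ Real.exp (2 * a * R * (t - s)) := by
      rw [Real.one_le_exp_iff]
      have := sub_nonneg.2 hs
      positivity
    linarith
  | succ n ih =>
    intro s hs x
    have hVx := hV x
    rcases le_or_gt R (V x) with hRV | hRV
    · refine (le_add_self.trans (sum_Piter_add_jumpTail hfin hQ hq t (n + 1) s hs x).le).trans ?_
      rw [← ENNReal.ofReal_one]
      apply ENNReal.ofReal_le_ofReal
      have h1 : 1 ≤ Real.exp (-∫ τ in t..s, c τ) * V x / R := by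
        rw [le_div_iff₀ hR]
        nlinarith [hg1 s hs]
      have h2 : 0 ≤ (1 / 2 : ℝ) ^ (n + 1) * Real.exp (2 * a * R * (t - s)) := by positivity
      linarith
    let g : ℝ → ℝ := fun r => Real.exp (-∫ τ in t..r, c τ)
    let e : ℝ → ℝ := fun r => Real.exp (-∫ τ in s..r, qIntensity Q τ x)
    let b : ℝ → ℝ := fun r => (1 / 2) ^ n * Real.exp (2 * a * R * (t - r))
    let q : ℝ → ℝ := fun r => qIntensity Q r x
    have hgd : ∀ r, HasDerivAt g (g r * -c r) r := hasDerivAt_exp_neg_integral hc t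
    have hed : ∀ r, HasDerivAt e (e r * -q r) r := hasDerivAt_exp_neg_integral (hq x) s
    have hgc : Continuous g := continuous_exp_neg_integral hc t
    have hec : Continuous e := continuous_exp_neg_integral (hq x) s
    have hbc : Continuous b := by fun_prop
    have hbd : ∀ r, HasDerivAt b (b r * -(2 * a * R)) r := by
      intro r
      have := ((((hasDerivAt_id r).const_sub t).const_mul (2 * a * R)).exp).const_mul
        ((1 / 2 : ℝ) ^ n)
      refine this.congr_deriv ?_
      simp only [b, id]
      ring
    have hg0 : ∀ r, 0 < g r := fun r => Real.exp_pos _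
    have he0 : ∀ r, 0 < e r := fun r => Real.exp_pos _
    have hb0 : ∀ r, 0 < b r := fun r => by positivity
    have hq0 : ∀ r, 0 ≤ q r := fun r => ENNReal.toReal_nonneg
    let G : ℝ → ℝ := fun r => -(V x / R * (e r * g r)) - b r / 2
    let G' : ℝ → ℝ := fun r => V x / R * (e r * g r * (c r + q r)) + b r * (a * R)
    have hGd : ∀ r, HasDerivAt G (G' r) r := by
      intro r
      have := ((((hed r).mul (hgd r)).const_mul (V x / R)).neg).sub ((hbd r).div_const 2)
      refine this.congr_deriv ?_
      simp only [G']
      ring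
    have hGc : Continuous G' := by
      have : Continuous q := hq x
      fun_prop
    have hG0 : ∀ r, s ≤ r → 0 ≤ G' r := by
      intro r _
      have := hg0 r; have := he0 r; have := hb0 r; have := hq0 r; have := hc0 r
      positivity
    have hinner : ∀ r ∈ Ioc s t, ∫⁻ y, jumpTail Q t n r y ∂(Q r x) ≤
        ENNReal.ofReal (g r / R * (c r * V x + q r * V x) + b r * q r) := by
      intro r hr
      have := hfin r x
      have hgr : 0 ≤ g r / R := by have := hg0 r; positivity
      calc ∫⁻ y, jumpTail Q t n r y ∂(Q r x)
          ≤ ∫⁻ y, (ENNReal.ofReal (g r / R) * ENNReal.ofReal (V y) + ENNReal.ofReal (b r))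
              ∂(Q r x) := by
            refine lintegral_mono fun y => (ih r hr.2 y).trans_eq ?_
            rw [← ENNReal.ofReal_mul hgr, ← ENNReal.ofReal_add (mul_nonneg hgr (hV y)) (hb0 r).le]
            congr 2
            simp only [g]
            ring
        _ = ENNReal.ofReal (g r / R) * ∫⁻ y, ENNReal.ofReal (V y) ∂(Q r x)
              + ENNReal.ofReal (b r) * ENNReal.ofReal (q r) := by
            rw [lintegral_add_right _ measurable_const,
              lintegral_const_mul _ hVm.ennreal_ofReal, lintegral_const]
            simp only [q, qIntensity]
            rw [ENNReal.ofReal_toReal (measure_ne_top _ _)]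
        _ ≤ ENNReal.ofReal (g r / R) * ENNReal.ofReal (c r * V x + q r * V x)
              + ENNReal.ofReal (b r) * ENNReal.ofReal (q r) := by
            gcongr
            exact hlyap r x
        _ = _ := by
            rw [← ENNReal.ofReal_mul hgr, ← ENNReal.ofReal_mul (hb0 r).le, ← ENNReal.ofReal_add]
            · have := hq0 r; have := hc0 r
              positivity
            · exact mul_nonneg (hb0 r).le (hq0 r)
    calc jumpTail Q t (n + 1) s x
        ≤ ∫⁻ r in Ioc s t, ENNReal.ofReal (G' r) := by
          refine setLIntegral_mono' measurableSet_Ioc fun r hr => ?_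
          refine (mul_le_mul_right (hinner r hr) _).trans ?_
          rw [holdingWeight, ← ENNReal.ofReal_mul (Real.exp_pos _).le]
          apply ENNReal.ofReal_le_ofReal
          have he1 : e r ≤ 1 := by
            rw [Real.exp_le_one_iff, neg_nonpos]
            exact intervalIntegral.integral_nonneg hr.1.le fun r _ => ENNReal.toReal_nonneg
          have hqa : q r ≤ a * R := (hbound r hr.2 x).trans (by gcongr)
          have hlast : e r * (b r * q r) ≤ b r * (a * R) := by
            have h1 : b r * q r ≤ b r * (a * R) := by have := hb0 r; gcongr
            exact (mul_le_of_le_one_left (mul_nonneg (hb0 r).le (hq0 r)) he1).trans h1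
          change e r * (g r / R * (c r * V x + q r * V x) + b r * q r) ≤
            V x / R * (e r * g r * (c r + q r)) + b r * (a * R)
          have : e r * (g r / R * (c r * V x + q r * V x) + b r * q r) =
            V x / R * (e r * g r * (c r + q r)) + e r * (b r * q r) := by ring
          linarith
      _ = ENNReal.ofReal (G t - G s) := lintegral_Ioc_ofReal_deriv hs hGd hGc hG0
      _ ≤ _ := by
          apply ENNReal.ofReal_le_ofReal
          have hes : e s = 1 := by simp [e]
          have h1 : 0 ≤ V x / R * (e t * g t) := by
            have := hg0 t; have := he0 t
            positivity
          have h2 := hb0 t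
          have h3 : g s * V x / R + (1 / 2) ^ (n + 1) * Real.exp (2 * a * R * (t - s)) = -G s := by
            simp only [G, hes, b]
            ring
          change G t - G s ≤ g s * V x / R + (1 / 2) ^ (n + 1) * Real.exp (2 * a * R * (t - s))
          rw [h3]
          simp only [G]
          linarith

lemma Pmin_univ_eq_one_of_lyapunov [MeasurableSpace E] {Q : ℝ → E → Measure E} {V : E → ℝ}
    {c : ℝ → ℝ} (hfin : ∀ r x, IsFiniteMeasure (Q r x))
    (hQ : Measurable fun p : ℝ × E => Q p.1 p.2)
    (hq : ∀ x, Continuous fun r => qIntensity Q r x) (hVm : Measurable V) (hV : ∀ x, 0 ≤ V x)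
    (hc : Continuous c) (hc0 : ∀ r, 0 ≤ c r)
    (hlyap : ∀ r x, ∫⁻ y, ENNReal.ofReal (V y) ∂(Q r x)
      ≤ ENNReal.ofReal (c r * V x + qIntensity Q r x * V x))
    {t a : ℝ} (ha : 0 < a) (hbound : ∀ r, r ≤ t → ∀ x, qIntensity Q r x ≤ a * V x)
    {s : ℝ} (hs : s ≤ t) (x : E) : Pmin Q s t x univ = 1 := by
  rw [Pmin, Measure.sum_apply _ MeasurableSet.univ]
  have hpart := fun n => sum_Piter_add_jumpTail hfin hQ hq t n s hs x
  apply le_antisymm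
  · rw [ENNReal.tsum_eq_iSup_nat]
    exact iSup_le fun n => le_self_add.trans (hpart n).le
  · set S := ∑' n, Piter Q n s t x univ
    set D := Real.exp (-∫ τ in t..s, c τ) * V x
    have hn : ∀ R > 0, 1 ≤ S + ENNReal.ofReal (D / R) := by
      intro R hR
      have hlim : Tendsto (fun n : ℕ => S + ENNReal.ofReal
          (D / R + (1 / 2) ^ n * Real.exp (2 * a * R * (t - s)))) atTop
          (𝓝 (S + ENNReal.ofReal (D / R + 0 * Real.exp (2 * a * R * (t - s))))) :=
        (ENNReal.tendsto_ofReal (((tendsto_pow_atTop_nhds_zero_of_lt_one (by norm_num)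
          (by norm_num)).mul_const _).const_add _)).const_add _
      rw [zero_mul, add_zero] at hlim
      refine ge_of_tendsto' hlim fun n => ?_
      rw [← hpart n]
      exact add_le_add (ENNReal.sum_le_tsum _)
        (jumpTail_le hfin hQ hq hVm hV hc hc0 hlyap ha hbound hR n s hs x)
    have hlim : Tendsto (fun R : ℝ => S + ENNReal.ofReal (D / R)) atTop
        (𝓝 (S + ENNReal.ofReal 0)) :=
      (ENNReal.tendsto_ofReal (tendsto_const_nhds.div_atTop tendsto_id)).const_add _
    rw [ENNReal.ofReal_zero, add_zero] at hlim
    exact ge_of_tendsto hlim ((eventually_gt_atTop 0).mono hn)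

lemma Piter_congr [MeasurableSpace E] {Q Q' : ℝ → E → Measure E}
    (h : ∀ r, 0 ≤ r → ∀ x, Q r x = Q' r x) (t : ℝ) (n : ℕ) :
    ∀ s, 0 ≤ s → s ≤ t → ∀ x, Piter Q n s t x = Piter Q' n s t x := by
  have hint : ∀ s r, 0 ≤ s → s ≤ r → ∀ x,
      ∫ τ in s..r, qIntensity Q τ x = ∫ τ in s..r, qIntensity Q' τ x := by
    intro s r hs hr x
    refine intervalIntegral.integral_congr fun τ hτ => ?_
    rw [uIcc_of_le hr] at hτ
    simp only [qIntensity]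
    rw [h τ (hs.trans hτ.1)]
  induction n with
  | zero =>
    intro s hs hst x
    rw [Piter, Piter, hint s t hs hst]
  | succ n ih =>
    intro s hs hst x
    rw [Piter, Piter]
    have hd : (volume.restrict (Ioc s t)).withDensity (fun r =>
          ENNReal.ofReal (Real.exp (-∫ τ in s..r, qIntensity Q τ x))) =
        (volume.restrict (Ioc s t)).withDensity fun r =>
          ENNReal.ofReal (Real.exp (-∫ τ in s..r, qIntensity Q' τ x)) := by
      refine withDensity_congr_ae ?_
      filter_upwards [ae_restrict_mem measurableSet_Ioc] with r hr
      rw [hint s r hs hr.1.le]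
    rw [hd]
    refine Measure.bind_congr_right ((withDensity_absolutelyContinuous _ _).ae_le ?_)
    filter_upwards [ae_restrict_mem measurableSet_Ioc] with r hr
    have hr0 := hs.trans hr.1.le
    rw [h r hr0]
    congr 1
    funext y
    exact ih r hr0 hr.2 y

/-- Under the standing hypotheses (H), the minimal transition function
`P` is conservative: `P(s,x;t,E) = 1` for all `0 ≤ s ≤ t` and all `x ∈ E`. -/
theorem minimal_transition_function_conservative [MeasurableSpace E] [TopologicalSpace E]
    [BorelSpace E] [PolishSpace E] [LocallyCompactSpace E]
    (Q : ℝ → E → Measure E) (V : E → ℝ) (c : ℝ → ℝ)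
    (hQ : IsTransitionFunction Q) (hH : StandingHypotheses Q V c) :
    ∀ s t : ℝ, 0 ≤ s → s ≤ t → ∀ x : E, Pmin Q s t x univ = 1 := by
  intro s t hs hst x
  let Q' : ℝ → E → Measure E := fun r y => Q (max r 0) y
  have hpos : ∀ r : ℝ, 0 ≤ max r 0 := fun r => le_max_right _ _
  have hP : Pmin Q s t x = Pmin Q' s t x := by
    unfold Pmin
    congr 1
    funext n
    exact Piter_congr (fun r hr y => by simp only [Q', max_eq_left hr]) t n s hs hst x
  have hmeas : Measurable fun p : ℝ × E => Q' p.1 p.2 :=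
    Measure.measurable_of_measurable_coe _ fun A hA =>
      (hQ.2.2.1 A hA).comp ((measurable_fst.max measurable_const).prodMk measurable_snd)
  have hqc : ∀ y, Continuous fun r => qIntensity Q' r y := by
    intro y
    have h1 := hH.weak_cont (fun _ => 1) continuous_const
      ⟨1, fun z => by have := hH.V_nonneg z; simp; linarith⟩
    have h2 : Continuous fun r : ℝ => ∫ _, (1 : ℝ) ∂(Q (max r 0) y) :=
      h1.comp_continuous (f := fun r : ℝ => (max r 0, y)) (by fun_prop) hpos
    simpa [Measure.real, qIntensity, Q'] using h2
  obtain ⟨a, ha, hbound⟩ := hH.q_bound (max t 1) (by positivity)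
  rw [hP]
  exact Pmin_univ_eq_one_of_lyapunov (c := fun r => c (max r 0)) (fun r y => hQ.1 _ y (hpos r))
    hmeas hqc hH.V_cont.measurable hH.V_nonneg (hH.c_cont.comp (by fun_prop))
    (fun r => hH.c_nonneg _) (fun r y => hH.lyapunov _ (hpos r) y) ha
    (fun r hr y => hbound _ ⟨hpos r, max_le (hr.trans (le_max_left _ _)) (by positivity)⟩ y) hst x
end

section
/- Let E be a locally compact Polish space and Q a transition function satisfying the standing hypotheses (H). Then for all 0 ≤ s ≤ t and x ∈ E one has ∫_E V(y) P(s,x;t,dy) ≤ V(x) exp(∫_s^t c(r) dr). Consequently, for every measurable F : E → ℝ with ‖F‖_V := sup_x |F(x)|/(1+V(x)) < ∞, the function U(s,t)F(x) := ∫_E F(y)P(s,x;t,dy) is well defined and satisfies ‖U(s,t)F‖_V ≤ e^{∫_s^t c(r)dr} ‖F‖_V. -/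
open MeasureTheory Set

variable {E : Type*}

/-- The lower integral of a finite sum dominates the sum of the lower integrals, without any
measurability assumption. -/
theorem sum_lintegral_le_lintegral_sum {α ι : Type*} [MeasurableSpace α] (μ : Measure α)
    (s : Finset ι) (f : ι → α → ENNReal) :
    ∑ i ∈ s, ∫⁻ a, f i a ∂μ ≤ ∫⁻ a, ∑ i ∈ s, f i a ∂μ := by
  classical
  induction s using Finset.induction_on with
  | empty => simp
  | insert i s hi ih =>
    simp only [Finset.sum_insert hi]
    exact (add_le_add le_rfl ih).trans (le_lintegral_add _ _)

/-- Integration against a bind is dominated by the iterated integral, even if the family of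
measures is not measurable. -/
theorem lintegral_bind_le {α β : Type*} [MeasurableSpace α] [MeasurableSpace β] (m : Measure α)
    (μ : α → Measure β) {f : β → ENNReal} (hf : Measurable f) :
    ∫⁻ y, f y ∂(Measure.bind m μ) ≤ ∫⁻ a, ∫⁻ y, f y ∂(μ a) ∂m := by
  by_cases h : AEMeasurable μ m
  · exact (Measure.lintegral_bind h hf.aemeasurable).le
  · simp [Measure.bind, Measure.map_of_not_aemeasurable h]

theorem lintegral_Piter_succ_le [MeasurableSpace E] (Q : ℝ → E → Measure E) {f : E → ENNReal}
    (hf : Measurable f) (n : ℕ) {s t : ℝ} (x : E) {q : ℝ → ℝ} (hq : Continuous q)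
    (hqQ : ∀ r ∈ Icc s t, q r = qIntensity Q r x) :
    ∫⁻ y, f y ∂(Piter Q (n + 1) s t x) ≤
      ∫⁻ r in Ioc s t, ENNReal.ofReal (Real.exp (-∫ τ in s..r, q τ)) *
        ∫⁻ y, ∫⁻ z, f z ∂(Piter Q n r t y) ∂(Q r x) := by
  have hdens : ((volume.restrict (Ioc s t)).withDensity fun r =>
      ENNReal.ofReal (Real.exp (-∫ τ in s..r, qIntensity Q τ x))) =
      (volume.restrict (Ioc s t)).withDensity fun r =>
        ENNReal.ofReal (Real.exp (-∫ τ in s..r, q τ)) := by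
    refine withDensity_congr_ae ?_
    filter_upwards [ae_restrict_mem measurableSet_Ioc] with r hr
    have hint : ∫ τ in s..r, qIntensity Q τ x = ∫ τ in s..r, q τ := by
      refine intervalIntegral.integral_congr fun τ hτ => ?_
      rw [uIcc_of_le hr.1.le] at hτ
      exact (hqQ τ ⟨hτ.1, hτ.2.trans hr.2⟩).symm
    rw [hint]
  have hmeas : Measurable fun r => ENNReal.ofReal (Real.exp (-∫ τ in s..r, q τ)) := by
    have hcont : Continuous fun r => ∫ τ in s..r, q τ :=
      intervalIntegral.continuous_primitive (fun a b => hq.intervalIntegrable a b) s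
    exact (Real.continuous_exp.comp hcont.neg).measurable.ennreal_ofReal
  rw [Piter, hdens]
  refine (lintegral_bind_le _ _ hf).trans ?_
  refine (lintegral_withDensity_le_lintegral_mul _ hmeas _).trans ?_
  exact lintegral_mono fun r => mul_le_mul_right (lintegral_bind_le _ _ hf) _

/-- The variation of constants identity behind the Lyapunov estimate. -/
theorem exp_neg_add_integral_eq_exp {q c : ℝ → ℝ} (hq : Continuous q) (hc : Continuous c)
    (s t : ℝ) :
    Real.exp (-∫ τ in s..t, q τ) + ∫ r in s..t, Real.exp (-∫ τ in s..r, q τ) *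
        (Real.exp (∫ τ in r..t, c τ) * (c r + q r)) =
      Real.exp (∫ τ in s..t, c τ) := by
  have hcI : ∀ a b, IntervalIntegrable c volume a b := fun a b => hc.intervalIntegrable a b
  have hqI : ∀ a b, IntervalIntegrable q volume a b := fun a b => hq.intervalIntegrable a b
  have hder : ∀ r, HasDerivAt
      (fun r => -(Real.exp (-∫ τ in s..r, q τ) * Real.exp (∫ τ in r..t, c τ)))
      (Real.exp (-∫ τ in s..r, q τ) * (Real.exp (∫ τ in r..t, c τ) * (c r + q r))) r := by
    intro r
    have h1 := (intervalIntegral.integral_hasDerivAt_right (hqI s r)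
      (hq.stronglyMeasurableAtFilter _ _) hq.continuousAt).neg.exp
    have h2 := (intervalIntegral.integral_hasDerivAt_left (hcI r t)
      (hc.stronglyMeasurableAtFilter _ _) hc.continuousAt).exp
    refine (h1.mul h2).neg.congr_deriv ?_
    rw [Pi.neg_apply]
    ring
  have hcont : Continuous fun r => Real.exp (-∫ τ in s..r, q τ) *
      (Real.exp (∫ τ in r..t, c τ) * (c r + q r)) := by
    have h1 : Continuous fun r => ∫ τ in s..r, q τ :=
      intervalIntegral.continuous_primitive hqI s
    have h2 : Continuous fun r => ∫ τ in r..t, c τ := by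
      simp_rw [intervalIntegral.integral_symm t]
      exact (intervalIntegral.continuous_primitive hcI t).neg
    fun_prop
  rw [intervalIntegral.integral_eq_sub_of_hasDerivAt (fun r _ => hder r)
    (hcont.intervalIntegrable s t)]
  simp

/-- Lyapunov estimate for the partial sums of the minimal transition function. -/
theorem sum_lintegral_Piter_le [MeasurableSpace E] (Q : ℝ → E → Measure E) {W : E → ℝ}
    {c : ℝ → ℝ} (hW : Measurable W) (hW0 : ∀ x, 0 ≤ W x) (hc : Continuous c)
    (hc0 : ∀ t, 0 ≤ c t) (hq : ∀ x, ContinuousOn (fun t => qIntensity Q t x) (Ici 0))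
    (hlyap : ∀ t, 0 ≤ t → ∀ x, ∫⁻ y, ENNReal.ofReal (W y) ∂(Q t x) ≤
      ENNReal.ofReal ((c t + qIntensity Q t x) * W x)) (N : ℕ) :
    ∀ s t : ℝ, 0 ≤ s → s ≤ t → ∀ x,
      ∑ n ∈ Finset.range N, ∫⁻ y, ENNReal.ofReal (W y) ∂(Piter Q n s t x) ≤
        ENNReal.ofReal (W x * Real.exp (∫ r in s..t, c r)) := by
  induction N with
  | zero => simp
  | succ N ih =>
    intro s t hs hst x
    obtain ⟨q, hqc, hqQ⟩ : ∃ q : ℝ → ℝ, Continuous q ∧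
        ∀ r, 0 ≤ r → q r = qIntensity Q r x :=
      ⟨fun r => qIntensity Q (max r 0) x,
        (hq x).comp_continuous (by fun_prop) fun r => le_max_right r 0,
        fun r hr => by simp [max_eq_left hr]⟩
    have hq0 : ∀ r, 0 ≤ r → 0 ≤ q r := fun r hr => by
      rw [hqQ r hr]; exact ENNReal.toReal_nonneg
    have hWm : Measurable fun y => ENNReal.ofReal (W y) := hW.ennreal_ofReal
    set k : ℝ → ℝ := fun r => Real.exp (-∫ τ in s..r, q τ) *
      (Real.exp (∫ τ in r..t, c τ) * (c r + q r)) with hk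
    have hkc : Continuous k := by
      have h1 : Continuous fun r => ∫ τ in s..r, q τ :=
        intervalIntegral.continuous_primitive (fun a b => hqc.intervalIntegrable a b) s
      have h2 : Continuous fun r => ∫ τ in r..t, c τ := by
        simp_rw [intervalIntegral.integral_symm t]
        exact (intervalIntegral.continuous_primitive
          (fun a b => hc.intervalIntegrable a b) t).neg
      fun_prop
    have hk0 : ∀ r, 0 ≤ r → 0 ≤ k r := fun r hr => by
      have := add_nonneg (hc0 r) (hq0 r hr)
      positivity
    have hzero : ∫⁻ y, ENNReal.ofReal (W y) ∂(Piter Q 0 s t x) =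
        ENNReal.ofReal (W x * Real.exp (-∫ τ in s..t, q τ)) := by
      have hint : ∫ τ in s..t, qIntensity Q τ x = ∫ τ in s..t, q τ := by
        refine intervalIntegral.integral_congr fun τ hτ => ?_
        rw [uIcc_of_le hst] at hτ
        exact (hqQ τ (hs.trans hτ.1)).symm
      rw [Piter, lintegral_smul_measure, lintegral_dirac' _ hWm, hint, smul_eq_mul,
        ← ENNReal.ofReal_mul (Real.exp_nonneg _), mul_comm]
    have hsucc : ∑ n ∈ Finset.range N, ∫⁻ y, ENNReal.ofReal (W y) ∂(Piter Q (n + 1) s t x) ≤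
        ENNReal.ofReal (W x * ∫ r in s..t, k r) := by
      calc _ ≤ ∑ n ∈ Finset.range N, ∫⁻ r in Ioc s t,
              ENNReal.ofReal (Real.exp (-∫ τ in s..r, q τ)) *
                ∫⁻ y, ∫⁻ z, ENNReal.ofReal (W z) ∂(Piter Q n r t y) ∂(Q r x) :=
            Finset.sum_le_sum fun n _ => lintegral_Piter_succ_le Q hWm n x hqc
              fun r hr => hqQ r (hs.trans hr.1)
        _ ≤ ∫⁻ r in Ioc s t, ∑ n ∈ Finset.range N,
              ENNReal.ofReal (Real.exp (-∫ τ in s..r, q τ)) *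
                ∫⁻ y, ∫⁻ z, ENNReal.ofReal (W z) ∂(Piter Q n r t y) ∂(Q r x) :=
            sum_lintegral_le_lintegral_sum _ _ _
        _ ≤ ∫⁻ r in Ioc s t, ENNReal.ofReal (W x * k r) := by
            refine setLIntegral_mono (hkc.const_mul _ |>.measurable.ennreal_ofReal) fun r hr => ?_
            have hr0 : 0 ≤ r := hs.trans hr.1.le
            rw [← Finset.mul_sum]
            have hinner : ∑ n ∈ Finset.range N,
                ∫⁻ y, ∫⁻ z, ENNReal.ofReal (W z) ∂(Piter Q n r t y) ∂(Q r x) ≤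
                ENNReal.ofReal (Real.exp (∫ τ in r..t, c τ) * ((c r + q r) * W x)) := by
              refine (sum_lintegral_le_lintegral_sum _ _ _).trans ?_
              refine (lintegral_mono fun y => ih r t hr0 hr.2 y).trans ?_
              simp_rw [mul_comm (W _), ENNReal.ofReal_mul (Real.exp_nonneg _)]
              rw [lintegral_const_mul _ hWm, hqQ r hr0]
              exact mul_le_mul_right (hlyap r hr0 x) _
            refine (mul_le_mul_right hinner _).trans_eq ?_
            rw [← ENNReal.ofReal_mul (Real.exp_nonneg _), hk]
            congr 1
            ring
        _ = ENNReal.ofReal (W x * ∫ r in s..t, k r) := by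
            rw [← intervalIntegral.integral_const_mul, intervalIntegral.integral_of_le hst,
              ofReal_integral_eq_lintegral_ofReal]
            · exact (hkc.const_mul _).integrableOn_Ioc
            · filter_upwards [ae_restrict_mem measurableSet_Ioc] with r hr
              exact mul_nonneg (hW0 x) (hk0 r (hs.trans hr.1.le))
    rw [Finset.sum_range_succ', hzero, add_comm]
    refine (add_le_add le_rfl hsucc).trans_eq ?_
    rw [← ENNReal.ofReal_add (mul_nonneg (hW0 x) (Real.exp_nonneg _)), ← mul_add,
      exp_neg_add_integral_eq_exp hqc hc]
    refine mul_nonneg (hW0 x) (intervalIntegral.integral_nonneg hst fun r hr => ?_)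
    exact hk0 r (hs.trans hr.1)

/-- Lyapunov estimate for the minimal transition function. -/
theorem lintegral_Pmin_le [MeasurableSpace E] (Q : ℝ → E → Measure E) {W : E → ℝ}
    {c : ℝ → ℝ} (hW : Measurable W) (hW0 : ∀ x, 0 ≤ W x) (hc : Continuous c)
    (hc0 : ∀ t, 0 ≤ c t) (hq : ∀ x, ContinuousOn (fun t => qIntensity Q t x) (Ici 0))
    (hlyap : ∀ t, 0 ≤ t → ∀ x, ∫⁻ y, ENNReal.ofReal (W y) ∂(Q t x) ≤
      ENNReal.ofReal ((c t + qIntensity Q t x) * W x))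
    {s t : ℝ} (hs : 0 ≤ s) (hst : s ≤ t) (x : E) :
    ∫⁻ y, ENNReal.ofReal (W y) ∂(Pmin Q s t x) ≤
      ENNReal.ofReal (W x * Real.exp (∫ r in s..t, c r)) := by
  rw [Pmin, lintegral_sum_measure, ENNReal.tsum_eq_iSup_nat]
  exact iSup_le fun N => sum_lintegral_Piter_le Q hW hW0 hc hc0 hq hlyap N s t hs hst x

/-- Under the standing hypotheses (H), one has
`∫_E V(y) P(s,x;t,dy) ≤ V(x) exp(∫_s^t c(r) dr)`, and for every measurable `F` with
finite `V`-norm the function `U(s,t)F` is well defined with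
`‖U(s,t)F‖_V ≤ e^{∫_s^t c(r)dr} ‖F‖_V`. -/
theorem lyapunov_estimate_and_V_norm_bound [MeasurableSpace E] [TopologicalSpace E]
    [BorelSpace E] [PolishSpace E] [LocallyCompactSpace E]
    (Q : ℝ → E → Measure E) (V : E → ℝ) (c : ℝ → ℝ)
    (hQ : IsTransitionFunction Q) (hH : StandingHypotheses Q V c) :
    ∀ s t : ℝ, 0 ≤ s → s ≤ t → ∀ x : E,
      (∫⁻ y, ENNReal.ofReal (V y) ∂(Pmin Q s t x)
          ≤ ENNReal.ofReal (V x * Real.exp (∫ r in s..t, c r))) ∧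
      (∀ F : E → ℝ, Measurable F → (∃ M : ℝ, ∀ x', |F x'| ≤ M * (1 + V x')) →
        Integrable F (Pmin Q s t x) ∧
        |Umin Q s t F x| / (1 + V x)
          ≤ Real.exp (∫ r in s..t, c r) * ⨆ x', |F x'| / (1 + V x')) := by
  intro s t hs hst x
  have hV := hH.V_cont.measurable
  have hpos : ∀ y, 0 < 1 + V y := fun y => by linarith [hH.V_nonneg y]
  have hq : ∀ x, ContinuousOn (fun t => qIntensity Q t x) (Ici 0) := by
    intro x
    have h := hH.weak_cont (fun _ => 1) continuous_const
      ⟨1, fun y => by simpa using hH.V_nonneg y⟩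
    have h' := h.comp (s := Ici (0 : ℝ)) (f := fun t => (t, x)) (by fun_prop) fun t ht => ht
    simpa [Function.comp_def, qIntensity, Measure.real] using h'
  refine ⟨lintegral_Pmin_le Q hV hH.V_nonneg hH.c_cont hH.c_nonneg hq
    (fun t ht x => (hH.lyapunov t ht x).trans_eq (by ring_nf)) hs hst x, ?_⟩
  have hone : ∫⁻ y, ENNReal.ofReal (1 + V y) ∂(Pmin Q s t x) ≤
      ENNReal.ofReal ((1 + V x) * Real.exp (∫ r in s..t, c r)) := by
    refine lintegral_Pmin_le Q (W := fun y => 1 + V y) (hV.const_add 1) (fun y => (hpos y).le)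
      hH.c_cont hH.c_nonneg hq (fun t ht x => ?_) hs hst x
    have := hQ.1 t x ht
    have hq0 : 0 ≤ qIntensity Q t x := ENNReal.toReal_nonneg
    have hmass : Q t x univ = ENNReal.ofReal (qIntensity Q t x) :=
      (ENNReal.ofReal_toReal (measure_ne_top _ _)).symm
    simp_rw [fun y => ENNReal.ofReal_add zero_le_one (hH.V_nonneg y)]
    rw [lintegral_add_left measurable_const, ENNReal.ofReal_one, lintegral_one, hmass]
    refine (add_le_add le_rfl (hH.lyapunov t ht x)).trans ?_
    have := mul_nonneg (hH.c_nonneg t) (hH.V_nonneg x)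
    have := mul_nonneg hq0 (hH.V_nonneg x)
    rw [← ENNReal.ofReal_add hq0 (by linarith)]
    refine ENNReal.ofReal_le_ofReal ?_
    linarith [hH.c_nonneg t]
  have hint : Integrable (fun y => 1 + V y) (Pmin Q s t x) := by
    refine ⟨(hV.const_add 1).aestronglyMeasurable, ?_⟩
    rw [hasFiniteIntegral_iff_ofReal (.of_forall fun y => (hpos y).le)]
    exact hone.trans_lt ENNReal.ofReal_lt_top
  have hintle : ∫ y, (1 + V y) ∂(Pmin Q s t x) ≤ (1 + V x) * Real.exp (∫ r in s..t, c r) := by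
    rw [integral_eq_lintegral_of_nonneg_ae (.of_forall fun y => (hpos y).le)
      (hV.const_add 1).aestronglyMeasurable]
    exact ENNReal.toReal_le_of_le_ofReal (mul_nonneg (hpos x).le (Real.exp_nonneg _)) hone
  rintro F hF ⟨M, hM⟩
  set K : ℝ := ⨆ x', |F x'| / (1 + V x')
  have hbdd : BddAbove (range fun x' => |F x'| / (1 + V x')) :=
    ⟨M, by rintro _ ⟨y, rfl⟩; exact (div_le_iff₀ (hpos y)).2 (hM y)⟩
  have hFK : ∀ y, |F y| ≤ K * (1 + V y) := fun y =>
    (div_le_iff₀ (hpos y)).1 (le_ciSup hbdd y)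
  have hK : 0 ≤ K := Real.iSup_nonneg fun y => div_nonneg (abs_nonneg _) (hpos y).le
  have hdom : Integrable (fun y => K * (1 + V y)) (Pmin Q s t x) := hint.const_mul K
  refine ⟨hdom.mono' hF.aestronglyMeasurable (.of_forall hFK), ?_⟩
  rw [div_le_iff₀ (hpos x)]
  calc |Umin Q s t F x| ≤ ∫ y, K * (1 + V y) ∂(Pmin Q s t x) :=
        norm_integral_le_of_norm_le (f := F) hdom (.of_forall hFK)
    _ = K * ∫ y, (1 + V y) ∂(Pmin Q s t x) := integral_const_mul _ _
    _ ≤ K * ((1 + V x) * Real.exp (∫ r in s..t, c r)) := mul_le_mul_of_nonneg_left hintle hK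
    _ = Real.exp (∫ r in s..t, c r) * K * (1 + V x) := by ring
end

section
/- Let E be a locally compact Polish space, Q a weakly continuous transition function with the localization property, and (Q_j)_{j∈ℕ} weakly continuous transition functions such that: sup_{j≥1} sup_{(t,x)∈B} Q_j(t,x,E) < ∞ for every compact B ⊆ [0,∞) × E, and for every f ∈ C_b(E×E) the convergence ∫_E f(x,w) Q_j(t,x,dw) → ∫_E f(x,w) Q(t,x,dw) (j → ∞) holds uniformly in (t,x) on every compact subset of [0,∞) × E. Then for every ε > 0, every T > 0 and every compact B ⊆ E there exist a compact A ⊆ E and j₀ ≥ 1 such that ∫_0^T Q_j(t,x,E∖A) dt ≤ ε for all x ∈ B and all j ≥ j₀. -/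
open MeasureTheory Set

variable {E : Type*}

/-- `Q` is weakly continuous: `(t,x) ↦ ∫_E F(y) Q(t,x,dy)` is continuous for every
bounded continuous `F`. -/
def WeaklyContinuous [MeasurableSpace E] [TopologicalSpace E]
    (Q : ℝ → E → Measure E) : Prop :=
  ∀ F : E → ℝ, Continuous F → (∃ M : ℝ, ∀ x, |F x| ≤ M) →
    ContinuousOn (fun p : ℝ × E => ∫ y, F y ∂(Q p.1 p.2)) {p : ℝ × E | 0 ≤ p.1}

/-- `Q` has the localization property. -/
def LocalizationProperty [MeasurableSpace E] [TopologicalSpace E]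
    (Q : ℝ → E → Measure E) : Prop :=
  ∀ ε > (0 : ℝ), ∀ B : Set E, IsCompact B → ∀ T > (0 : ℝ),
    ∃ A : Set E, IsCompact A ∧ ∀ x ∈ B, ∫ r in (0 : ℝ)..T, (Q r x Aᶜ).toReal < ε

/-- The α-regularized evolution `U_α(s,t)F(x) = Σ_n αⁿ ∫_E F(y) P⁽ⁿ⁾(s,x;t,dy)`. -/
noncomputable def Ualpha [MeasurableSpace E] (Q : ℝ → E → Measure E) (α : ℝ)
    (s t : ℝ) (F : E → ℝ) (x : E) : ℝ :=
  ∑' n : ℕ, α ^ n * ∫ y, F y ∂(Piter Q n s t x)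

/-- The mass that a transition function puts on a measurable set is integrable in time. -/
theorem IsTransitionFunction.intervalIntegrable_toReal [MeasurableSpace E] [TopologicalSpace E]
    {Q : ℝ → E → Measure E} (hQ : IsTransitionFunction Q) {T : ℝ} (hT : 0 < T) (x : E)
    {A : Set E} (hA : MeasurableSet A) :
    IntervalIntegrable (fun t => (Q t x A).toReal) volume 0 T := by
  obtain ⟨hfin, -, hmeas, hbound⟩ := hQ
  obtain ⟨C, hC⟩ := hbound T hT {x} isCompact_singleton
  rw [intervalIntegrable_iff_integrableOn_Icc_of_le hT.le]
  have hm : Measurable fun t => (Q t x A).toReal :=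
    ((hmeas A hA).comp (measurable_id.prodMk measurable_const)).ennreal_toReal
  refine Measure.integrableOn_of_bounded (M := C) (by simp) hm.aestronglyMeasurable ?_
  refine (ae_restrict_iff' measurableSet_Icc).2 (Filter.Eventually.of_forall fun t ht => ?_)
  have := hfin t x ht.1
  rw [Real.norm_of_nonneg ENNReal.toReal_nonneg]
  exact (measureReal_mono (subset_univ A)).trans (hC t ht x rfl)

/-- For a compact set `K` in a locally compact space there is a continuous function with values
in `[0, 1]` which vanishes on `K` and equals `1` off some closed compact set. -/
theorem IsCompact.exists_continuous_between_compl [TopologicalSpace E] [R1Space E]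
    [LocallyCompactSpace E] {K : Set E} (hK : IsCompact K) :
    ∃ A : Set E, IsCompact A ∧ IsClosed A ∧ ∃ g : E → ℝ, Continuous g ∧
      (∀ x, g x ∈ Icc (0 : ℝ) 1) ∧ (∀ x ∈ K, g x = 0) ∧ ∀ x ∉ A, g x = 1 := by
  obtain ⟨f, hf1, -, hfc, hf01⟩ :=
    exists_continuous_one_zero_of_isCompact hK isClosed_empty (disjoint_empty K)
  refine ⟨tsupport f, hfc, isClosed_tsupport f, fun x => 1 - f x,
    continuous_const.sub f.continuous, fun x => ?_, fun x hx => ?_, fun x hx => ?_⟩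
  · exact ⟨by linarith [(hf01 x).2], by linarith [(hf01 x).1]⟩
  · simp [hf1 hx]
  · simp [image_eq_zero_of_notMem_tsupport hx]

/-- A function which is at least the indicator of `S` has integral at least the mass of `S`. -/
theorem toReal_measure_le_integral [MeasurableSpace E] {μ : Measure E} [IsFiniteMeasure μ]
    {g : E → ℝ} (hg : Integrable g μ) (hg0 : ∀ x, 0 ≤ g x) {S : Set E} (hS : MeasurableSet S)
    (hgS : ∀ x ∈ S, 1 ≤ g x) : (μ S).toReal ≤ ∫ x, g x ∂μ := by
  calc (μ S).toReal = ∫ x, S.indicator (fun _ => (1 : ℝ)) x ∂μ := by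
        rw [integral_indicator hS]; simp [Measure.real]
    _ ≤ ∫ x, g x ∂μ := integral_mono ((integrable_const _).indicator hS) hg fun x => by
        by_cases hx : x ∈ S
        · simpa [hx] using hgS x hx
        · simpa [hx] using hg0 x

/-- A function which is at most the indicator of `S` has integral at most the mass of `S`. -/
theorem integral_le_toReal_measure [MeasurableSpace E] {μ : Measure E} [IsFiniteMeasure μ]
    {g : E → ℝ} (hg : Integrable g μ) (hg1 : ∀ x, g x ≤ 1) {S : Set E} (hS : MeasurableSet S)
    (hgS : ∀ x ∉ S, g x ≤ 0) : ∫ x, g x ∂μ ≤ (μ S).toReal := by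
  calc ∫ x, g x ∂μ ≤ ∫ x, S.indicator (fun _ => (1 : ℝ)) x ∂μ :=
        integral_mono hg ((integrable_const _).indicator hS) fun x => by
          by_cases hx : x ∈ S
          · simpa [hx] using hg1 x
          · simpa [hx] using hgS x hx
    _ = (μ S).toReal := by rw [integral_indicator hS]; simp [Measure.real]

/-- If `Q` is weakly continuous with the localization property and the
weakly continuous transition functions `Q_j` are uniformly bounded on compacts of
`[0,∞) × E` and converge to `Q` in the sense that
`∫_E f(x,w) Q_j(t,x,dw) → ∫_E f(x,w) Q(t,x,dw)` uniformly on compacts of `[0,∞) × E`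
for every `f ∈ C_b(E×E)`, then for every `ε > 0`, `T > 0` and compact `B ⊆ E` there
exist a compact `A ⊆ E` and `j₀` such that `∫_0^T Q_j(t,x,E∖A) dt ≤ ε` for all
`x ∈ B`, `j ≥ j₀`. -/
theorem uniform_localization_of_approximations [MeasurableSpace E] [TopologicalSpace E]
    [BorelSpace E] [PolishSpace E] [LocallyCompactSpace E]
    (Q : ℝ → E → Measure E) (Qj : ℕ → ℝ → E → Measure E)
    (hQ : IsTransitionFunction Q) (hQw : WeaklyContinuous Q)
    (hQloc : LocalizationProperty Q)
    (hQj : ∀ j, IsTransitionFunction (Qj j)) (hQjw : ∀ j, WeaklyContinuous (Qj j))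
    (hbdd : ∀ K : Set (ℝ × E), IsCompact K → K ⊆ {p : ℝ × E | 0 ≤ p.1} →
      ∃ C : ℝ, ∀ j : ℕ, 1 ≤ j → ∀ p ∈ K, (Qj j p.1 p.2 univ).toReal ≤ C)
    (hconv : ∀ f : E × E → ℝ, Continuous f → (∃ M : ℝ, ∀ p, |f p| ≤ M) →
      ∀ K : Set (ℝ × E), IsCompact K → K ⊆ {p : ℝ × E | 0 ≤ p.1} →
        TendstoUniformlyOn
          (fun j (p : ℝ × E) => ∫ w, f (p.2, w) ∂(Qj j p.1 p.2))
          (fun p : ℝ × E => ∫ w, f (p.2, w) ∂(Q p.1 p.2)) Filter.atTop K) :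
    ∀ ε > (0 : ℝ), ∀ T > (0 : ℝ), ∀ B : Set E, IsCompact B →
      ∃ A : Set E, IsCompact A ∧ ∃ j₀ : ℕ, 1 ≤ j₀ ∧ ∀ j ≥ j₀, ∀ x ∈ B,
        ∫ t in (0 : ℝ)..T, (Qj j t x Aᶜ).toReal ≤ ε := by
  intro ε hε T hT B hB
  obtain ⟨K, hK, hKint⟩ := hQloc (ε / 2) (half_pos hε) B hB T hT
  obtain ⟨A, hA, hAcl, g, hgc, hg01, hgK, hgA⟩ := hK.exists_continuous_between_compl
  have hg_int : ∀ (μ : Measure E) [IsFiniteMeasure μ], Integrable g μ := fun μ _ =>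
    Integrable.of_bound hgc.aestronglyMeasurable 1 (Filter.Eventually.of_forall fun x => by
      rw [Real.norm_of_nonneg (hg01 x).1]; exact (hg01 x).2)
  have hconv_g := hconv (fun p => g p.2) (hgc.comp continuous_snd)
    ⟨1, fun p => abs_le.2 ⟨by linarith [(hg01 p.2).1], (hg01 p.2).2⟩⟩
    (Icc 0 T ×ˢ B) (isCompact_Icc.prod hB) fun p hp => hp.1.1
  obtain ⟨N, hN⟩ := Filter.eventually_atTop.1
    (Metric.tendstoUniformlyOn_iff.1 hconv_g (ε / (2 * T)) (by positivity))
  refine ⟨A, hA, max 1 N, le_max_left _ _, fun j hj x hx => ?_⟩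
  have hAm : MeasurableSet Aᶜ := hAcl.measurableSet.compl
  have hKm : MeasurableSet Kᶜ := hK.measurableSet.compl
  have hQK := hQ.intervalIntegrable_toReal hT x hKm
  have hle : ∀ t ∈ Icc 0 T, (Qj j t x Aᶜ).toReal ≤ (Q t x Kᶜ).toReal + ε / (2 * T) := by
    intro t ht
    have := hQ.1 t x ht.1
    have := (hQj j).1 t x ht.1
    have hlow := toReal_measure_le_integral (hg_int (Qj j t x)) (fun y => (hg01 y).1) hAm
      fun y hy => (hgA y hy).ge
    have hupp := integral_le_toReal_measure (hg_int (Q t x)) (fun y => (hg01 y).2) hKm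
      fun y hy => (hgK y (not_not.1 hy)).le
    have hdist := hN j (le_of_max_le_right hj) (t, x) ⟨ht, hx⟩
    rw [Real.dist_eq] at hdist
    linarith [(abs_lt.1 hdist).1]
  calc ∫ t in (0 : ℝ)..T, (Qj j t x Aᶜ).toReal
      ≤ ∫ t in (0 : ℝ)..T, ((Q t x Kᶜ).toReal + ε / (2 * T)) :=
        intervalIntegral.integral_mono_on hT.le ((hQj j).intervalIntegrable_toReal hT x hAm)
          (hQK.add intervalIntegrable_const) hle
    _ = (∫ t in (0 : ℝ)..T, (Q t x Kᶜ).toReal) + ε / 2 := by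
        rw [intervalIntegral.integral_add hQK intervalIntegrable_const,
          intervalIntegral.integral_const, smul_eq_mul]
        field_simp
        ring
    _ ≤ ε := by linarith [hKint x hx]
end
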